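/- arXiv:1911.01749 — 4 statements merged into one kernel-verified Lean document; each statement's English description precedes it below -/
import Mathlib

section
/- Let p, q, r, s ≥ 3 be four pairwise coprime prime powers with r, s > max(p, q). If r ≡ s (mod pq), then C(Φ*_{pqr}) = C(Φ*_{pqs}); if r ≡ −s (mod pq), then C(Φ*_{pqr}) = −C(Φ*_{pqs}) = {−c : c ∈ C(Φ*_{pqs})}. -/
open Polynomial

/-- The unitary cyclotomic polynomial `Φ*_n = ∏_{d ∣ n, rad(d) = rad(n)} Φ_d`. -/
noncomputable def unitaryCyclotomic (n : ℕ) : Polynomial ℤ :=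
  ∏ d ∈ n.divisors.filter (fun d => d.primeFactors = n.primeFactors), cyclotomic d ℤ

/-- The set of coefficients of a polynomial `f`, i.e. all values `f.coeff j` for
`0 ≤ j ≤ deg f`. -/
def coeffSet (f : Polynomial ℤ) : Set ℤ := {c : ℤ | ∃ j ≤ f.natDegree, f.coeff j = c}

open Finset

section Factorization

lemma dvd_iff_not_dvd_of_dvd_mul_prime_pow {m R e d : ℕ} (hR : R.Prime)
    (hm : Nat.Coprime m (R ^ e)) (he : e ≠ 0) (hd : d ∣ m * R ^ e) : d ∣ m ↔ ¬ R ∣ d := by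
  constructor
  · intro h hRd
    have h1 : R ∣ Nat.gcd m (R ^ e) := Nat.dvd_gcd (hRd.trans h) (dvd_pow_self R he)
    rw [hm] at h1
    exact hR.one_lt.ne' (Nat.dvd_one.1 h1)
  · intro h
    have h1 : Nat.Coprime d (R ^ e) := ((hR.coprime_iff_not_dvd.2 h).symm).pow_right e
    exact h1.dvd_of_dvd_mul_right hd

lemma divisors_eq_filter_of_dvd {n k : ℕ} (hn : n ≠ 0) (h : k ∣ n) :
    k.divisors = n.divisors.filter (· ∣ k) := by
  ext d
  simp only [Nat.mem_divisors, mem_filter]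
  constructor
  · rintro ⟨h1, _⟩
    exact ⟨⟨h1.trans h, hn⟩, h1⟩
  · rintro ⟨_, h1⟩
    exact ⟨h1, ne_zero_of_dvd_ne_zero hn h⟩

lemma X_pow_sub_one_eq_prod_ite {n k : ℕ} (hn : n ≠ 0) (h : k ∣ n) :
    (X ^ k - 1 : ℤ[X]) = ∏ d ∈ n.divisors, if d ∣ k then cyclotomic d ℤ else 1 := by
  rw [← prod_filter, ← divisors_eq_filter_of_dvd hn h]
  exact (prod_cyclotomic_eq_X_pow_sub_one
    (Nat.pos_of_ne_zero (ne_zero_of_dvd_ne_zero hn h)) ℤ).symm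

lemma unitaryCyclotomic_mul_eq {p q r : ℕ} (hp : IsPrimePow p) (hq : IsPrimePow q)
    (hr : IsPrimePow r) (hpq : Nat.Coprime p q) (hpr : Nat.Coprime p r) (hqr : Nat.Coprime q r) :
    unitaryCyclotomic (p * q * r) *
        ((X - 1) * (X ^ (p * q) - 1) * (X ^ (p * r) - 1) * (X ^ (q * r) - 1)) =
      (X ^ (p * q * r) - 1) * (X ^ p - 1) * (X ^ q - 1) * (X ^ r - 1) := by
  have hn : p * q * r ≠ 0 := mul_ne_zero (mul_ne_zero hp.ne_zero hq.ne_zero) hr.ne_zero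
  obtain ⟨P, a, hP, ha, rfl⟩ := (isPrimePow_nat_iff _).1 hp
  obtain ⟨Q, b, hQ, hb, rfl⟩ := (isPrimePow_nat_iff _).1 hq
  obtain ⟨R, c, hR, hc, rfl⟩ := (isPrimePow_nat_iff _).1 hr
  have h1 : (X - 1 : ℤ[X]) = X ^ 1 - 1 := by rw [pow_one]
  rw [h1, unitaryCyclotomic, prod_filter,
    X_pow_sub_one_eq_prod_ite hn (one_dvd _),
    X_pow_sub_one_eq_prod_ite hn (Dvd.intro _ rfl : P ^ a * Q ^ b ∣ _),
    X_pow_sub_one_eq_prod_ite hn (⟨Q ^ b, by ring⟩ : P ^ a * R ^ c ∣ _),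
    X_pow_sub_one_eq_prod_ite hn (⟨P ^ a, by ring⟩ : Q ^ b * R ^ c ∣ _),
    X_pow_sub_one_eq_prod_ite hn (dvd_refl (P ^ a * Q ^ b * R ^ c)),
    X_pow_sub_one_eq_prod_ite hn (⟨Q ^ b * R ^ c, by ring⟩ : P ^ a ∣ _),
    X_pow_sub_one_eq_prod_ite hn (⟨P ^ a * R ^ c, by ring⟩ : Q ^ b ∣ _),
    X_pow_sub_one_eq_prod_ite hn (⟨P ^ a * Q ^ b, by ring⟩ : R ^ c ∣ _)]
  simp only [← prod_mul_distrib]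
  refine prod_congr rfl fun d hd => ?_
  have hd' : d ∣ P ^ a * Q ^ b * R ^ c := Nat.dvd_of_mem_divisors hd
  have hd0 : d ≠ 0 := ne_zero_of_dvd_ne_zero hn hd'
  have eR : d ∣ P ^ a * Q ^ b ↔ ¬ R ∣ d :=
    dvd_iff_not_dvd_of_dvd_mul_prime_pow hR (Nat.Coprime.mul_left hpr hqr) hc.ne' hd'
  have eQ : d ∣ P ^ a * R ^ c ↔ ¬ Q ∣ d :=
    dvd_iff_not_dvd_of_dvd_mul_prime_pow hQ (Nat.Coprime.mul_left hpq hqr.symm) hb.ne'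
      (by rwa [mul_right_comm])
  have eP : d ∣ Q ^ b * R ^ c ↔ ¬ P ∣ d :=
    dvd_iff_not_dvd_of_dvd_mul_prime_pow hP (Nat.Coprime.mul_left hpq.symm hpr.symm) ha.ne'
      (by rwa [mul_comm, ← mul_assoc])
  have fP : d ∣ P ^ a ↔ ¬ Q ∣ d ∧ ¬ R ∣ d := by
    rw [← eR]
    constructor
    · intro h
      have h' : d ∣ P ^ a * Q ^ b := h.mul_right _
      exact ⟨(dvd_iff_not_dvd_of_dvd_mul_prime_pow hQ hpq hb.ne' h').1 h, h'⟩
    · rintro ⟨h, h'⟩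
      exact (dvd_iff_not_dvd_of_dvd_mul_prime_pow hQ hpq hb.ne' h').2 h
  have fQ : d ∣ Q ^ b ↔ ¬ P ∣ d ∧ ¬ R ∣ d := by
    rw [← eR, mul_comm]
    constructor
    · intro h
      have h' : d ∣ Q ^ b * P ^ a := h.mul_right _
      exact ⟨(dvd_iff_not_dvd_of_dvd_mul_prime_pow hP hpq.symm ha.ne' h').1 h, h'⟩
    · rintro ⟨h, h'⟩
      exact (dvd_iff_not_dvd_of_dvd_mul_prime_pow hP hpq.symm ha.ne' h').2 h
  have fR : d ∣ R ^ c ↔ ¬ P ∣ d ∧ ¬ Q ∣ d := by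
    rw [← eQ, mul_comm]
    constructor
    · intro h
      have h' : d ∣ R ^ c * P ^ a := h.mul_right _
      exact ⟨(dvd_iff_not_dvd_of_dvd_mul_prime_pow hP hpr.symm ha.ne' h').1 h, h'⟩
    · rintro ⟨h, h'⟩
      exact (dvd_iff_not_dvd_of_dvd_mul_prime_pow hP hpr.symm ha.ne' h').2 h
  have f1 : d ∣ 1 ↔ ¬ P ∣ d ∧ ¬ Q ∣ d ∧ ¬ R ∣ d := by
    constructor
    · intro h
      rw [Nat.dvd_one.1 h]
      simp [hP.ne_one, hQ.ne_one, hR.ne_one]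
    · rintro ⟨h1, h2, h3⟩
      have h4 : d ∣ P ^ a := fP.2 ⟨h2, h3⟩
      have h5 : d ∣ Q ^ b := fQ.2 ⟨h1, h3⟩
      rw [← hpq.gcd_eq_one]
      exact Nat.dvd_gcd h4 h5
  have fr : d.primeFactors = (P ^ a * Q ^ b * R ^ c).primeFactors ↔ P ∣ d ∧ Q ∣ d ∧ R ∣ d := by
    have hPQR : (P ^ a * Q ^ b * R ^ c).primeFactors = {P, Q, R} := by
      rw [Nat.primeFactors_mul (left_ne_zero_of_mul hn) (right_ne_zero_of_mul hn),
        Nat.primeFactors_mul (left_ne_zero_of_mul (left_ne_zero_of_mul hn))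
          (right_ne_zero_of_mul (left_ne_zero_of_mul hn)),
        Nat.primeFactors_prime_pow ha.ne' hP, Nat.primeFactors_prime_pow hb.ne' hQ,
        Nat.primeFactors_prime_pow hc.ne' hR]
      ext x
      simp
    constructor
    · intro h
      rw [hPQR] at h
      refine ⟨?_, ?_, ?_⟩ <;> exact Nat.dvd_of_mem_primeFactors (by rw [h]; simp)
    · rintro ⟨h1, h2, h3⟩
      refine Subset.antisymm (Nat.primeFactors_mono hd' hn) ?_
      rw [hPQR]
      intro x hx
      simp only [mem_insert, mem_singleton] at hx
      rcases hx with rfl | rfl | rfl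
      · exact Nat.mem_primeFactors.2 ⟨hP, h1, hd0⟩
      · exact Nat.mem_primeFactors.2 ⟨hQ, h2, hd0⟩
      · exact Nat.mem_primeFactors.2 ⟨hR, h3, hd0⟩
  simp only [eP, eQ, eR, fP, fQ, fR, f1, fr, hd', if_true]
  by_cases hPd : P ∣ d <;> by_cases hQd : Q ∣ d <;> by_cases hRd : R ∣ d <;>
    simp [hPd, hQd, hRd]

end Factorization

section Combinatorics

/-- For `g * p + h * q = p * q + 1`, the coefficient of `X ^ i` in
`(X ^ (p * q) - 1) * (X - 1) / ((X ^ p - 1) * (X ^ q - 1))`. -/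
def binaryCoeff (p q g h i : ℕ) : ℤ :=
  if i < p * q then
    if i * g % q < g ∧ i * h % p < h then 1
    else if g ≤ i * g % q ∧ h ≤ i * h % p then -1 else 0
  else 0

/-- For `p < q`, the `p * q`-periodic extension of the sequence of coefficients of
`(1 - X ^ p) * (1 - X ^ q) / (1 - X)`. -/
def periodicCoeff (p q : ℕ) (t : ℤ) : ℤ :=
  if t % (p * q : ℤ) < p then 1
  else if (q : ℤ) ≤ t % (p * q : ℤ) ∧ t % (p * q : ℤ) < q + p then -1 else 0

/-- The truncated convolution of `binaryCoeff`, stretched by `r`, with `periodicCoeff`. -/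
def truncatedConv (p q g h : ℕ) (r : ℤ) (N : ℕ) (m : ℤ) : ℤ :=
  ∑ i ∈ range N, binaryCoeff p q g h i * periodicCoeff p q (m - r * i)

lemma exists_mul_add_mul_eq {p q : ℕ} (hp3 : 3 ≤ p) (hq3 : 3 ≤ q) (hpq : Nat.Coprime p q) :
    ∃ g h : ℕ, g < q ∧ h < p ∧ g * p + h * q = p * q + 1 := by
  obtain ⟨m, hmq, hm⟩ := Nat.exists_mul_mod_eq_one_of_coprime hpq (by omega)
  have h1 := Nat.div_add_mod (p * m) q
  rw [hm] at h1
  generalize p * m / q = t at h1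
  have ht : t < p := by
    by_contra hc
    push Not at hc
    nlinarith
  have ht0 : 0 < t := by
    rcases Nat.eq_zero_or_pos t with h | h
    · rw [h, mul_zero, zero_add] at h1
      have := Nat.dvd_one.1 (Dvd.intro m h1.symm)
      omega
    · exact h
  refine ⟨m, p - t, hmq, by omega, ?_⟩
  obtain ⟨k, rfl⟩ := Nat.exists_eq_add_of_lt ht
  have : t + k + 1 - t = k + 1 := by omega
  rw [this]
  nlinarith

variable {p q g h : ℕ}

lemma mul_mod_add_mul_mod_modEq (hpq : Nat.Coprime p q) (hgh : g * p + h * q = p * q + 1)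
    (i : ℕ) : i * g % q * p + i * h % p * q ≡ i [MOD p * q] := by
  have key : i * (g * p) + i * (h * q) = i * (p * q) + i := by
    rw [← mul_add, hgh]; ring
  rw [← Nat.modEq_and_modEq_iff_modEq_mul hpq]
  constructor
  · calc i * g % q * p + i * h % p * q ≡ 0 + i * h * q [MOD p] :=
          Nat.ModEq.add (Nat.modEq_zero_iff_dvd.2 (dvd_mul_left _ _))
            ((Nat.mod_modEq _ _).mul_right _)
      _ ≡ i * g * p + i * h * q [MOD p] :=
          Nat.ModEq.add_right _ (Nat.modEq_zero_iff_dvd.2 (dvd_mul_left _ _)).symm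
      _ = p * (i * q) + i := by linarith
      _ ≡ 0 + i [MOD p] := Nat.ModEq.add_right _ (Nat.modEq_zero_iff_dvd.2 (dvd_mul_right _ _))
      _ = i := zero_add i
  · calc i * g % q * p + i * h % p * q ≡ i * g * p + 0 [MOD q] :=
          Nat.ModEq.add ((Nat.mod_modEq _ _).mul_right _)
            (Nat.modEq_zero_iff_dvd.2 (dvd_mul_left _ _))
      _ ≡ i * g * p + i * h * q [MOD q] :=
          Nat.ModEq.add_left _ (Nat.modEq_zero_iff_dvd.2 (dvd_mul_left _ _)).symm
      _ = q * (i * p) + i := by linarith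
      _ ≡ 0 + i [MOD q] := Nat.ModEq.add_right _ (Nat.modEq_zero_iff_dvd.2 (dvd_mul_right _ _))
      _ = i := zero_add i

/-- The residues of `i * g` and `i * h` are the coordinates of `i` with respect to `p` and `q`. -/
lemma mul_mod_add_mul_mod_eq (hp : 0 < p) (hq : 0 < q) (hpq : Nat.Coprime p q)
    (hgh : g * p + h * q = p * q + 1) {i : ℕ} (hi : i < p * q) :
    i * g % q * p + i * h % p * q = i ∨ i * g % q * p + i * h % p * q = i + p * q := by
  have h1 := mul_mod_add_mul_mod_modEq hpq hgh i
  have hx := Nat.mod_lt (i * g) hq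
  have hy := Nat.mod_lt (i * h) hp
  generalize i * g % q = x at *
  generalize i * h % p = y at *
  have hlt : x * p + y * q < p * q + p * q := by nlinarith
  unfold Nat.ModEq at h1
  rw [Nat.mod_eq_of_lt hi] at h1
  have h2 := Nat.div_add_mod (x * p + y * q) (p * q)
  rw [h1] at h2
  have h3 : (x * p + y * q) / (p * q) < 2 := Nat.div_lt_of_lt_mul (by linarith)
  interval_cases (x * p + y * q) / (p * q)
  · left; linarith
  · right; linarith

lemma mul_mod_of_eq_add (hgh : g * p + h * q = p * q + 1) {i x y k : ℕ}
    (hx : x < q) (hi : x * p + y * q = i + k * q) : i * g % q = x := by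
  have h1 : i * g + q * (k * g + x * h) = x + q * (x * p + y * g) := by
    have : x * (g * p + h * q) + y * q * g = (x * p + y * q) * g + x * h * q := by ring
    rw [hgh, hi] at this
    nlinarith
  have h2 : (i * g + q * (k * g + x * h)) % q = (x + q * (x * p + y * g)) % q := by rw [h1]
  rwa [Nat.add_mul_mod_self_left, Nat.add_mul_mod_self_left, Nat.mod_eq_of_lt hx] at h2

lemma mul_mod_add_mul_mod_eq_of_lt (hp : 0 < p) (hq : 0 < q) (hpq : Nat.Coprime p q)
    (hgh : g * p + h * q = p * q + 1) {i : ℕ} (hi : i < p * q) (hx : i * g % q < g)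
    (hy : i * h % p < h) : i * g % q * p + i * h % p * q = i := by
  rcases mul_mod_add_mul_mod_eq hp hq hpq hgh hi with h1 | h1
  · exact h1
  · exfalso
    generalize i * g % q = x at *
    generalize i * h % p = y at *
    nlinarith [Nat.mul_le_mul_right p (Nat.succ_le_of_lt hx),
      Nat.mul_le_mul_right q (Nat.succ_le_of_lt hy)]

lemma mul_mod_add_mul_mod_eq_of_le (hp : 0 < p) (hq : 0 < q) (hpq : Nat.Coprime p q)
    (hgh : g * p + h * q = p * q + 1) {i : ℕ} (hi : i < p * q) (hx : g ≤ i * g % q)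
    (hy : h ≤ i * h % p) : i * g % q * p + i * h % p * q = i + p * q := by
  rcases mul_mod_add_mul_mod_eq hp hq hpq hgh hi with h1 | h1
  · exfalso
    generalize i * g % q = x at *
    generalize i * h % p = y at *
    nlinarith [Nat.mul_le_mul_right p hx, Nat.mul_le_mul_right q hy]
  · exact h1

/-- The polynomial with coefficients `binaryCoeff`. -/
noncomputable def binaryPoly (p q g h : ℕ) : ℤ[X] :=
  ∑ i ∈ range (p * q), Polynomial.C (binaryCoeff p q g h i) * X ^ i

lemma sum_filter_lt_X_pow (hp : 0 < p) (hq : 0 < q) (hgq : g ≤ q) (hhp : h ≤ p)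
    (hpq : Nat.Coprime p q) (hgh : g * p + h * q = p * q + 1) :
    ∑ i ∈ range (p * q) with i * g % q < g ∧ i * h % p < h, (X : ℤ[X]) ^ i =
      (∑ x ∈ range g, (X ^ p) ^ x) * ∑ y ∈ range h, (X ^ q) ^ y := by
  rw [sum_mul_sum, ← sum_product']
  refine sum_nbij' (fun i => (i * g % q, i * h % p)) (fun z => z.1 * p + z.2 * q) ?_ ?_ ?_ ?_ ?_
  · intro i hi
    simp only [mem_filter, mem_range, mem_product] at hi ⊢
    exact hi.2
  · rintro ⟨x, y⟩ hz
    simp only [mem_product, mem_range, mem_filter] at hz ⊢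
    obtain ⟨hx, hy⟩ := hz
    have e1 : (x * p + y * q) * g % q = x :=
      mul_mod_of_eq_add (y := y) (k := 0) hgh (hx.trans_le hgq) (by ring)
    have e2 : (x * p + y * q) * h % p = y :=
      mul_mod_of_eq_add (p := q) (q := p) (g := h) (h := g) (k := 0) (y := x)
        (by linarith) (hy.trans_le hhp) (by ring)
    refine ⟨?_, by rw [e1]; exact hx, by rw [e2]; exact hy⟩
    nlinarith [Nat.mul_le_mul_right p (Nat.succ_le_of_lt hx),
      Nat.mul_le_mul_right q (Nat.succ_le_of_lt hy)]
  · intro i hi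
    simp only [mem_filter, mem_range] at hi ⊢
    exact mul_mod_add_mul_mod_eq_of_lt hp hq hpq hgh hi.1 hi.2.1 hi.2.2
  · rintro ⟨x, y⟩ hz
    simp only [mem_product, mem_range] at hz ⊢
    obtain ⟨hx, hy⟩ := hz
    have e1 : (x * p + y * q) * g % q = x :=
      mul_mod_of_eq_add (y := y) (k := 0) hgh (hx.trans_le hgq) (by ring)
    have e2 : (x * p + y * q) * h % p = y :=
      mul_mod_of_eq_add (p := q) (q := p) (g := h) (h := g) (k := 0) (y := x)
        (by linarith) (hy.trans_le hhp) (by ring)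
    rw [e1, e2]
  · intro i hi
    simp only [mem_filter, mem_range] at hi ⊢
    rw [← pow_mul, ← pow_mul, ← pow_add, mul_comm p, mul_comm q,
      mul_mod_add_mul_mod_eq_of_lt hp hq hpq hgh hi.1 hi.2.1 hi.2.2]

lemma sum_filter_le_X_pow (hp : 0 < p) (hq : 0 < q) (hpq : Nat.Coprime p q)
    (hgh : g * p + h * q = p * q + 1) :
    (∑ i ∈ range (p * q) with g ≤ i * g % q ∧ h ≤ i * h % p, (X : ℤ[X]) ^ i) * X ^ (p * q) =
      (∑ x ∈ Ico g q, (X ^ p) ^ x) * ∑ y ∈ Ico h p, (X ^ q) ^ y := by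
  rw [sum_mul_sum, ← sum_product', sum_mul]
  have key : ∀ x y : ℕ, g ≤ x → x < q → h ≤ y → y < p →
      p * q ≤ x * p + y * q ∧ x * p + y * q - p * q < p * q ∧
      (x * p + y * q - p * q) * g % q = x ∧ (x * p + y * q - p * q) * h % p = y := by
    intro x y hgx hxq hhy hyp
    have h1 : p * q ≤ x * p + y * q := by
      nlinarith [Nat.mul_le_mul_right p hgx, Nat.mul_le_mul_right q hhy]
    have h2 : x * p + y * q < p * q + p * q := by nlinarith
    obtain ⟨i, hi⟩ := Nat.exists_eq_add_of_le h1
    have h3 : x * p + y * q - p * q = i := by omega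
    rw [h3]
    refine ⟨h1, by omega, ?_, ?_⟩
    · exact mul_mod_of_eq_add (y := y) (k := p) hgh hxq (by linarith)
    · exact mul_mod_of_eq_add (p := q) (q := p) (g := h) (h := g) (k := q) (y := x)
        (by linarith) hyp (by linarith)
  refine sum_nbij' (fun i => (i * g % q, i * h % p)) (fun z => z.1 * p + z.2 * q - p * q)
    ?_ ?_ ?_ ?_ ?_
  · intro i hi
    simp only [mem_filter, mem_range, mem_product, mem_Ico] at hi ⊢
    exact ⟨⟨hi.2.1, Nat.mod_lt _ hq⟩, hi.2.2, Nat.mod_lt _ hp⟩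
  · rintro ⟨x, y⟩ hz
    simp only [mem_product, mem_Ico, mem_range, mem_filter] at hz ⊢
    obtain ⟨⟨hgx, hxq⟩, hhy, hyp⟩ := hz
    obtain ⟨_, k2, k3, k4⟩ := key x y hgx hxq hhy hyp
    rw [k3, k4]
    exact ⟨k2, hgx, hhy⟩
  · intro i hi
    simp only [mem_filter, mem_range] at hi ⊢
    rw [mul_mod_add_mul_mod_eq_of_le hp hq hpq hgh hi.1 hi.2.1 hi.2.2, Nat.add_sub_cancel]
  · rintro ⟨x, y⟩ hz
    simp only [mem_product, mem_Ico] at hz ⊢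
    obtain ⟨⟨hgx, hxq⟩, hhy, hyp⟩ := hz
    obtain ⟨_, _, k3, k4⟩ := key x y hgx hxq hhy hyp
    rw [k3, k4]
  · intro i hi
    simp only [mem_filter, mem_range] at hi ⊢
    rw [← pow_mul, ← pow_mul, ← pow_add, ← pow_add, mul_comm p (i * g % q),
      mul_comm q (i * h % p), mul_mod_add_mul_mod_eq_of_le hp hq hpq hgh hi.1 hi.2.1 hi.2.2]

lemma binaryPoly_mul (hp : 0 < p) (hq : 0 < q) (hgq : g ≤ q) (hhp : h ≤ p)
    (hpq : Nat.Coprime p q) (hgh : g * p + h * q = p * q + 1) :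
    binaryPoly p q g h * ((X ^ p - 1) * (X ^ q - 1)) = (X ^ (p * q) - 1) * (X - 1) := by
  have h1 : binaryPoly p q g h =
      ∑ i ∈ range (p * q) with i * g % q < g ∧ i * h % p < h, (X : ℤ[X]) ^ i -
      ∑ i ∈ range (p * q) with g ≤ i * g % q ∧ h ≤ i * h % p, (X : ℤ[X]) ^ i := by
    rw [binaryPoly, sum_filter, sum_filter, ← sum_sub_distrib]
    refine sum_congr rfl fun i hi => ?_
    rw [mem_range] at hi
    rw [binaryCoeff, if_pos hi]
    by_cases hA : i * g % q < g ∧ i * h % p < h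
    · have hB : ¬ (g ≤ i * g % q ∧ h ≤ i * h % p) := by omega
      simp [hA, hB]
    · by_cases hB : g ≤ i * g % q ∧ h ≤ i * h % p <;> simp [hA, hB]
  have e1 := sum_filter_lt_X_pow hp hq hgq hhp hpq hgh
  have e2 := sum_filter_le_X_pow hp hq hpq hgh
  have g1 := geom_sum_mul ((X : ℤ[X]) ^ p) g
  have g2 := geom_sum_mul ((X : ℤ[X]) ^ q) h
  have g3 := geom_sum_Ico_mul ((X : ℤ[X]) ^ p) hgq
  have g4 := geom_sum_Ico_mul ((X : ℤ[X]) ^ q) hhp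
  have e3 : ((X : ℤ[X]) ^ p) ^ g * (X ^ q) ^ h = X ^ (p * q) * X := by
    rw [← pow_mul, ← pow_mul, ← pow_add, ← pow_succ]
    congr 1
    linarith
  have e4 : ((X : ℤ[X]) ^ p) ^ q = X ^ (p * q) := (pow_mul _ _ _).symm
  have e5 : ((X : ℤ[X]) ^ q) ^ p = X ^ (p * q) := by rw [← pow_mul, mul_comm]
  rw [e4] at g3
  rw [e5] at g4
  have hX : (X : ℤ[X]) ^ (p * q) ≠ 0 := pow_ne_zero _ X_ne_zero
  apply mul_left_cancel₀ hX
  rw [h1, e1]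
  generalize (∑ i ∈ range (p * q) with g ≤ i * g % q ∧ h ≤ i * h % p, (X : ℤ[X]) ^ i) = S at *
  generalize (∑ i ∈ range g, ((X : ℤ[X]) ^ p) ^ i) = A at *
  generalize (∑ i ∈ range h, ((X : ℤ[X]) ^ q) ^ i) = B at *
  generalize (∑ i ∈ Ico g q, ((X : ℤ[X]) ^ p) ^ i) = A' at *
  generalize (∑ i ∈ Ico h p, ((X : ℤ[X]) ^ q) ^ i) = B' at *
  generalize ((X : ℤ[X]) ^ p) ^ g = U at *
  generalize ((X : ℤ[X]) ^ q) ^ h = V at *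
  generalize (X : ℤ[X]) ^ (p * q) = W at *
  generalize (X : ℤ[X]) ^ p = Y at *
  generalize (X : ℤ[X]) ^ q = Z at *
  calc W * ((A * B - S) * ((Y - 1) * (Z - 1)))
      = W * ((A * (Y - 1)) * (B * (Z - 1))) - S * W * ((Y - 1) * (Z - 1)) := by ring
    _ = W * ((U - 1) * (V - 1)) - (A' * (Y - 1)) * (B' * (Z - 1)) := by rw [g1, g2, e2]; ring
    _ = W * ((W - 1) * (X - 1)) := by
      rw [g3, g4]; linear_combination (W - 1) * e3

/-- The power series `(1 - X ^ p) * (1 - X ^ q) / ((1 - X) * (1 - X ^ (p * q)))`. -/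
lemma mk_periodicCoeff_mul (hpltq : p < q) (hle : p + q ≤ p * q) :
    (PowerSeries.mk fun n : ℕ => periodicCoeff p q n) *
        ((PowerSeries.X ^ (p * q) - 1) * (PowerSeries.X - 1)) =
      (PowerSeries.X ^ p - 1) * (PowerSeries.X ^ q - 1) := by
  have h1 : (PowerSeries.mk fun n : ℕ => periodicCoeff p q n) * (PowerSeries.X ^ (p * q) - 1) =
      (∑ i ∈ range p, PowerSeries.X ^ i) * (PowerSeries.X ^ q - 1) := by
    ext n
    have hs : ∀ k, (PowerSeries.coeff k) (∑ i ∈ range p, (PowerSeries.X : PowerSeries ℤ) ^ i) =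
        if k < p then 1 else 0 := by
      intro k
      simp [PowerSeries.coeff_X_pow]
    rw [mul_sub, mul_sub, mul_one, mul_one, map_sub, map_sub, PowerSeries.coeff_mul_X_pow',
      PowerSeries.coeff_mul_X_pow', hs, hs, PowerSeries.coeff_mk, PowerSeries.coeff_mk]
    by_cases hn : p * q ≤ n
    · rw [if_pos hn, if_pos (by omega), if_neg (by omega), if_neg (by omega)]
      have : periodicCoeff p q ((n - p * q : ℕ) : ℤ) = periodicCoeff p q n := by
        unfold periodicCoeff
        have : ((n - p * q : ℕ) : ℤ) % (p * q : ℤ) = (n : ℤ) % (p * q : ℤ) := by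
          push_cast [hn]
          simp
        rw [this]
      rw [this]
      simp
    · have h2 : (n : ℤ) % (p * q : ℤ) = n :=
        Int.emod_eq_of_lt (by positivity) (by exact_mod_cast not_le.1 hn)
      rw [if_neg hn, periodicCoeff, h2]
      split_ifs <;> omega
  rw [← mul_assoc, h1, mul_right_comm, geom_sum_mul]

lemma coeff_expand_mul_mk (r : ℕ) (hr : 0 < r) (n : ℕ) :
    PowerSeries.coeff n (((expand ℤ r (binaryPoly p q g h) : ℤ[X]) : PowerSeries ℤ) *
        PowerSeries.mk fun n : ℕ => periodicCoeff p q n) =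
      truncatedConv p q g h r (n / r + 1) n := by
  have h1 : ((expand ℤ r (binaryPoly p q g h) : ℤ[X]) : PowerSeries ℤ) =
      ∑ i ∈ range (p * q), PowerSeries.C (binaryCoeff p q g h i) * PowerSeries.X ^ (r * i) := by
    rw [binaryPoly, map_sum, ← Polynomial.coeToPowerSeries.ringHom_apply, map_sum]
    refine sum_congr rfl fun i _ => ?_
    rw [map_mul, map_mul, expand_C, map_pow, expand_X, ← pow_mul]
    simp
  rw [h1, sum_mul, map_sum, truncatedConv]
  have h2 : ∀ i ∈ range (p * q), PowerSeries.coeff n (PowerSeries.C (binaryCoeff p q g h i) *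
      PowerSeries.X ^ (r * i) * PowerSeries.mk fun n : ℕ => periodicCoeff p q n) =
      if i ∈ range (n / r + 1) then
        binaryCoeff p q g h i * periodicCoeff p q ((n : ℤ) - (r : ℤ) * i) else 0 := by
    intro i _
    rw [mul_assoc, PowerSeries.coeff_C_mul, PowerSeries.coeff_X_pow_mul', PowerSeries.coeff_mk]
    have h3 : r * i ≤ n ↔ i ∈ range (n / r + 1) := by
      rw [mem_range, Nat.lt_succ_iff, Nat.le_div_iff_mul_le hr, mul_comm]
    by_cases hi : r * i ≤ n
    · rw [if_pos hi, if_pos (h3.1 hi)]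
      push_cast [hi]
      rfl
    · rw [if_neg hi, if_neg (fun h => hi (h3.2 h)), mul_zero]
  rw [sum_congr rfl h2, ← sum_filter, filter_mem_eq_inter, inter_comm, ← filter_mem_eq_inter,
    sum_filter]
  refine sum_congr rfl fun i _ => ?_
  split_ifs with hi
  · rfl
  · rw [binaryCoeff, if_neg (by simpa using hi), zero_mul]

lemma coeff_unitaryCyclotomic {r : ℕ} (hp : IsPrimePow p) (hq : IsPrimePow q)
    (hr : IsPrimePow r) (hpq : Nat.Coprime p q) (hpr : Nat.Coprime p r) (hqr : Nat.Coprime q r)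
    (hpltq : p < q) (hle : p + q ≤ p * q) (hgq : g ≤ q) (hhp : h ≤ p)
    (hgh : g * p + h * q = p * q + 1) (n : ℕ) :
    (unitaryCyclotomic (p * q * r)).coeff n = truncatedConv p q g h r (n / r + 1) n := by
  have hp0 := hp.pos
  have hq0 := hq.pos
  have hr0 := hr.pos
  have hX : ∀ k : ℕ, 0 < k → (X ^ k - 1 : ℤ[X]) ≠ 0 := fun k hk => X_pow_sub_C_ne_zero hk 1
  have h1 := unitaryCyclotomic_mul_eq hp hq hr hpq hpr hqr
  have h2 := congrArg (expand ℤ r) (binaryPoly_mul hp0 hq0 hgq hhp hpq hgh)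
  simp only [map_mul, map_sub, map_pow, expand_X, map_one, ← pow_mul] at h2
  have h3 : unitaryCyclotomic (p * q * r) * ((X ^ (p * q) - 1) * (X - 1)) =
      expand ℤ r (binaryPoly p q g h) * ((X ^ p - 1) * (X ^ q - 1)) := by
    apply mul_right_cancel₀ (mul_ne_zero (hX (p * r) (by positivity)) (hX (q * r) (by positivity)))
    rw [mul_comm r p, mul_comm r q, mul_comm r (p * q)] at h2
    linear_combination h1 - (X ^ p - 1) * (X ^ q - 1) * h2
  have h4 := congrArg (fun f : ℤ[X] => (f : PowerSeries ℤ)) h3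
  simp only [Polynomial.coe_mul, Polynomial.coe_sub, Polynomial.coe_pow, Polynomial.coe_X,
    Polynomial.coe_one] at h4
  rw [← mk_periodicCoeff_mul hpltq hle, ← mul_assoc _ (PowerSeries.mk _)] at h4
  have h5 : ((PowerSeries.X ^ (p * q) - 1) * (PowerSeries.X - 1) : PowerSeries ℤ) ≠ 0 := by
    have : ((((X ^ (p * q) - 1) * (X ^ 1 - 1) : ℤ[X])) : PowerSeries ℤ) ≠ 0 := by
      rw [Ne, Polynomial.coe_eq_zero_iff]
      exact mul_ne_zero (hX _ (by positivity)) (hX 1 one_pos)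
    simpa using this
  have h6 := mul_right_cancel₀ h5 h4
  rw [← coeff_expand_mul_mk r hr0, ← h6, Polynomial.coeff_coe]

lemma periodicCoeff_congr {s t : ℤ} (hst : s ≡ t [ZMOD (p * q : ℤ)]) :
    periodicCoeff p q s = periodicCoeff p q t := by
  unfold periodicCoeff
  rw [hst]

lemma truncatedConv_congr {r s : ℤ} {m n : ℤ} (hrs : r ≡ s [ZMOD (p * q : ℤ)])
    (hmn : m ≡ n [ZMOD (p * q : ℤ)]) (N : ℕ) :
    truncatedConv p q g h r N m = truncatedConv p q g h s N n := by
  unfold truncatedConv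
  refine sum_congr rfl fun i _ => ?_
  rw [periodicCoeff_congr (hmn.sub (hrs.mul_right (i : ℤ)))]

lemma periodicCoeff_reflect (hpltq : p < q) (hle : p + q ≤ p * q) (t : ℤ) :
    periodicCoeff p q (p + q - 1 - t) = -periodicCoeff p q t := by
  have hle' : (p : ℤ) + q ≤ p * q := by exact_mod_cast hle
  unfold periodicCoeff
  rw [Int.sub_emod, Int.emod_eq_of_lt (a := (p : ℤ) + q - 1) (by omega) (by omega)]
  have h0 : 0 ≤ t % (p * q : ℤ) := Int.emod_nonneg _ (by omega)
  have h1 : t % (p * q : ℤ) < p * q := Int.emod_lt_of_pos _ (by omega)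
  generalize t % (p * q : ℤ) = u at *
  generalize (p * q : ℤ) = M at *
  rcases le_or_gt u (p + q - 1) with hu | hu
  · rw [Int.emod_eq_of_lt (by omega) (by omega)]
    split_ifs <;> omega
  · have : ((p : ℤ) + q - 1 - u) % M = p + q - 1 - u + M := by
      rw [← Int.add_emod_right, Int.emod_eq_of_lt (by omega) (by omega)]
    rw [this]
    split_ifs <;> omega

lemma truncatedConv_reflect (hpltq : p < q) (hle : p + q ≤ p * q) {r s : ℤ}
    (hrs : r ≡ -s [ZMOD (p * q : ℤ)]) (N : ℕ) (m : ℤ) :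
    truncatedConv p q g h r N m = -truncatedConv p q g h s N (p + q - 1 - m) := by
  rw [truncatedConv_congr hrs (Int.ModEq.refl m)]
  unfold truncatedConv
  rw [← sum_neg_distrib]
  refine sum_congr rfl fun i _ => ?_
  rw [← mul_neg, ← periodicCoeff_reflect hpltq hle]
  congr 2
  ring

lemma periodicCoeff_add_one_sub (hp : 0 < p) (hpltq : p < q) (hlt : p + q < p * q) (t : ℤ) :
    periodicCoeff p q (t + 1) - periodicCoeff p q t =
      (if (p * q : ℤ) ∣ t + 1 then 1 else 0) - (if (p * q : ℤ) ∣ t + 1 - p then 1 else 0)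
        - (if (p * q : ℤ) ∣ t + 1 - q then 1 else 0)
        + (if (p * q : ℤ) ∣ t + 1 - p - q then 1 else 0) := by
  have hlt' : (p : ℤ) + q < p * q := by exact_mod_cast hlt
  have hd : ∀ k : ℤ, 0 ≤ k → k < p * q →
      ((p * q : ℤ) ∣ t + 1 - k ↔ (t + 1) % (p * q : ℤ) = k) := by
    intro k hk0 hk
    rw [← Int.emod_emod_of_dvd _ dvd_rfl, ← Int.emod_eq_emod_iff_emod_sub_eq_zero.trans
      Int.dvd_iff_emod_eq_zero.symm, Int.emod_eq_of_lt hk0 hk, Int.emod_emod_of_dvd _ dvd_rfl]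
  have hd0 := hd 0 le_rfl (by omega)
  rw [sub_zero] at hd0
  simp only [sub_sub (t + 1), hd0, hd p (by omega) (by omega), hd q (by omega) (by omega),
    hd (p + q) (by omega) (by omega)]
  have ht : t % (p * q : ℤ) = ((t + 1) % (p * q : ℤ) - 1) % (p * q : ℤ) := by
    rw [Int.emod_sub_emod, add_sub_cancel_right]
  unfold periodicCoeff
  rw [ht]
  have h0 : 0 ≤ (t + 1) % (p * q : ℤ) := Int.emod_nonneg _ (by omega)
  have h1 : (t + 1) % (p * q : ℤ) < p * q := Int.emod_lt_of_pos _ (by omega)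
  generalize (t + 1) % (p * q : ℤ) = u at *
  generalize (p * q : ℤ) = M at *
  rcases eq_or_lt_of_le h0 with hu | hu
  · have : (u - 1) % M = M - 1 := by
      rw [← Int.add_emod_right, Int.emod_eq_of_lt (by omega) (by omega)]
      omega
    rw [this]
    split_ifs <;> omega
  · rw [Int.emod_eq_of_lt (by omega) (by omega)]
    split_ifs <;> omega

lemma exists_sum_ite_dvd_eq (hp : 0 < p) (hq : 0 < q) {r : ℤ}
    (hr : IsCoprime r (p * q : ℤ)) (N : ℕ) (k : ℤ) :
    ∃ j < p * q, (p * q : ℤ) ∣ k - r * j ∧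
      ∑ i ∈ range N, binaryCoeff p q g h i * (if (p * q : ℤ) ∣ k - r * i then 1 else 0) =
        if j < N then binaryCoeff p q g h j else 0 := by
  obtain ⟨u, v, huv⟩ := hr
  have hM : (0 : ℤ) < p * q := by positivity
  obtain ⟨j, hj⟩ := Int.eq_ofNat_of_zero_le (Int.emod_nonneg (k * u) hM.ne')
  have hjlt : (j : ℤ) < p * q := hj ▸ Int.emod_lt_of_pos (k * u) hM
  have hj2 := Int.mul_ediv_add_emod (k * u) (p * q : ℤ)
  rw [hj] at hj2
  have hdvd : (p * q : ℤ) ∣ k - r * j :=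
    ⟨k * v + r * (k * u / (p * q : ℤ)), by linear_combination (-k) * huv - r * hj2⟩
  refine ⟨j, by exact_mod_cast hjlt, hdvd, ?_⟩
  rw [← sum_filter_add_sum_filter_not (range N) (· = j)]
  have h2 : ∑ i ∈ range N with ¬ i = j,
      binaryCoeff p q g h i * (if (p * q : ℤ) ∣ k - r * i then 1 else 0) = 0 := by
    refine sum_eq_zero fun i hi => ?_
    by_cases hid : (p * q : ℤ) ∣ k - r * i
    · have hij : i ≠ j := (mem_filter.1 hi).2
      rw [binaryCoeff, if_neg, zero_mul]
      intro hilt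
      have h3 : (p * q : ℤ) ∣ r * ((i : ℤ) - j) := by
        have := dvd_sub hdvd hid
        rwa [show k - r * j - (k - r * i) = r * ((i : ℤ) - j) by ring] at this
      have h4 : (p * q : ℤ) ∣ (i : ℤ) - j :=
        (IsCoprime.dvd_of_dvd_mul_left ⟨v, u, by linarith⟩ h3)
      have hilt' : (i : ℤ) < p * q := by exact_mod_cast hilt
      have := Int.eq_zero_of_abs_lt_dvd h4 (by rw [abs_lt]; constructor <;> omega)
      omega
    · rw [if_neg hid, mul_zero]
  rw [h2, add_zero, filter_eq']
  simp only [mem_range]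
  split_ifs with hjN
  · rw [sum_singleton, if_pos hdvd, mul_one]
  · exact sum_empty

lemma ite_lt_binaryCoeff (hp : 0 < p) (hq : 0 < q) (hpq : Nat.Coprime p q)
    (hgh : g * p + h * q = p * q + 1) {j : ℕ} (hj : j < p * q) (N : ℕ) :
    (if j < N then binaryCoeff p q g h j else 0) =
      if j * g % q < g ∧ j * h % p < h then
        if j * g % q * p + j * h % p * q < N then 1 else 0
      else if g ≤ j * g % q ∧ h ≤ j * h % p then
        if j * g % q * p + j * h % p * q < N + p * q then -1 else 0
      else 0 := by
  rw [binaryCoeff, if_pos hj]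
  by_cases h1 : j * g % q < g ∧ j * h % p < h
  · rw [if_pos h1, if_pos h1, mul_mod_add_mul_mod_eq_of_lt hp hq hpq hgh hj h1.1 h1.2]
  · rw [if_neg h1, if_neg h1]
    by_cases h2 : g ≤ j * g % q ∧ h ≤ j * h % p
    · rw [if_pos h2, if_pos h2, mul_mod_add_mul_mod_eq_of_le hp hq hpq hgh hj h2.1 h2.2]
      simp
    · rw [if_neg h2, if_neg h2, ite_self]

lemma mul_mod_eq_of_dvd {r c : ℤ} {M i j e : ℕ} (hr : IsCoprime r (M : ℤ))
    (hij : (M : ℤ) ∣ r * ((i : ℤ) - j) + M * c) : i * e % M = j * e % M := by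
  have h1 : (M : ℤ) ∣ r * ((i : ℤ) - j) := (dvd_add_left (Dvd.intro _ rfl)).1 hij
  have h2 : (M : ℤ) ∣ (i : ℤ) - j := hr.symm.dvd_of_dvd_mul_left h1
  have h3 : j ≡ i [MOD M] := (Nat.modEq_iff_dvd).2 h2
  exact (h3.mul_right e).symm

lemma abs_truncatedConv_add_one_sub_le (hp : 0 < p) (hpltq : p < q) (hlt : p + q < p * q)
    (hpq : Nat.Coprime p q) (hgh : g * p + h * q = p * q + 1) {r : ℤ}
    (hr : IsCoprime r (p * q : ℤ)) (N : ℕ) (m : ℤ) :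
    |truncatedConv p q g h r N (m + 1) - truncatedConv p q g h r N m| ≤ 1 := by
  have hq : 0 < q := hp.trans hpltq
  obtain ⟨j₁, hj₁, hd₁, hs₁⟩ := exists_sum_ite_dvd_eq (g := g) (h := h) hp hq hr N (m + 1)
  obtain ⟨j₂, hj₂, hd₂, hs₂⟩ := exists_sum_ite_dvd_eq (g := g) (h := h) hp hq hr N (m + 1 - p)
  obtain ⟨j₃, hj₃, hd₃, hs₃⟩ := exists_sum_ite_dvd_eq (g := g) (h := h) hp hq hr N (m + 1 - q)
  obtain ⟨j₄, hj₄, hd₄, hs₄⟩ :=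
    exists_sum_ite_dvd_eq (g := g) (h := h) hp hq hr N (m + 1 - p - q)
  have key : truncatedConv p q g h r N (m + 1) - truncatedConv p q g h r N m =
      (if j₁ < N then binaryCoeff p q g h j₁ else 0) -
      (if j₂ < N then binaryCoeff p q g h j₂ else 0) -
      (if j₃ < N then binaryCoeff p q g h j₃ else 0) +
      (if j₄ < N then binaryCoeff p q g h j₄ else 0) := by
    rw [← hs₁, ← hs₂, ← hs₃, ← hs₄, truncatedConv, truncatedConv, ← sum_sub_distrib,
      ← sum_sub_distrib, ← sum_sub_distrib, ← sum_add_distrib]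
    refine sum_congr rfl fun i _ => ?_
    have := periodicCoeff_add_one_sub hp hpltq hlt (m - r * i)
    rw [show m - r * i + 1 = m + 1 - r * i by ring,
      show m + 1 - r * i - p = m + 1 - p - r * i by ring,
      show m + 1 - r * i - q = m + 1 - q - r * i by ring,
      show m + 1 - p - r * i - q = m + 1 - p - q - r * i by ring] at this
    rw [← mul_sub, this]
    ring
  have hrp : IsCoprime r (p : ℤ) := hr.of_mul_right_left
  have hrq : IsCoprime r (q : ℤ) := hr.of_mul_right_right
  have dp : (p : ℤ) ∣ p * q := dvd_mul_right _ _
  have dq : (q : ℤ) ∣ p * q := dvd_mul_left _ _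
  have e₁₂ : j₂ * h % p = j₁ * h % p := by
    refine mul_mod_eq_of_dvd (c := 1) hrp ?_
    obtain ⟨k, hk⟩ := dp.trans (dvd_sub hd₁ hd₂)
    exact ⟨k, by linear_combination hk⟩
  have e₃₄ : j₄ * h % p = j₃ * h % p := by
    refine mul_mod_eq_of_dvd (c := 1) hrp ?_
    obtain ⟨k, hk⟩ := dp.trans (dvd_sub hd₃ hd₄)
    exact ⟨k, by linear_combination hk⟩
  have e₁₃ : j₃ * g % q = j₁ * g % q := by
    refine mul_mod_eq_of_dvd (c := 1) hrq ?_
    obtain ⟨k, hk⟩ := dq.trans (dvd_sub hd₁ hd₃)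
    exact ⟨k, by linear_combination hk⟩
  have e₂₄ : j₄ * g % q = j₂ * g % q := by
    refine mul_mod_eq_of_dvd (c := 1) hrq ?_
    obtain ⟨k, hk⟩ := dq.trans (dvd_sub hd₂ hd₄)
    exact ⟨k, by linear_combination hk⟩
  rw [key, ite_lt_binaryCoeff hp hq hpq hgh hj₁, ite_lt_binaryCoeff hp hq hpq hgh hj₂,
    ite_lt_binaryCoeff hp hq hpq hgh hj₃, ite_lt_binaryCoeff hp hq hpq hgh hj₄,
    e₁₂, e₃₄, e₁₃, e₂₄]
  clear * -
  generalize j₁ * g % q = x₁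
  generalize j₂ * g % q = x₂
  generalize j₁ * h % p = y₁
  generalize j₃ * h % p = y₂
  generalize hu₁ : x₁ * p = u₁
  generalize hu₂ : x₂ * p = u₂
  generalize hv₁ : y₁ * q = v₁
  generalize hv₂ : y₂ * q = v₂
  clear hu₁ hu₂ hv₁ hv₂
  generalize p * q = M
  rw [abs_le]
  rcases lt_or_ge x₁ g with hx₁ | hx₁ <;> rcases lt_or_ge x₂ g with hx₂ | hx₂ <;>
    rcases lt_or_ge y₁ h with hy₁ | hy₁ <;> rcases lt_or_ge y₂ h with hy₂ | hy₂ <;>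
    simp only [hx₁, hx₂, hy₁, hy₂, not_lt.2, not_le.2, and_true, and_false, if_true,
      if_false] <;>
    (try split_ifs) <;> omega

/-- Consecutive coefficients have opposite signs if they do not vanish. -/
lemma binaryCoeff_mul_succ_nonpos (hp : 0 < p) (hq : 0 < q) (hpq : Nat.Coprime p q)
    (hgh : g * p + h * q = p * q + 1) (i : ℕ) :
    binaryCoeff p q g h i * binaryCoeff p q g h (i + 1) ≤ 0 := by
  have key : ∀ x y x' y' k : ℕ, x * p + y * q = i + k → x' * p + y' * q = i + 1 + k →
      ∃ s t : ℤ, (x' : ℤ) - x - g = q * s ∧ (y' : ℤ) - y - h = p * t ∧ s + t = -1 := by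
    intro x y x' y' k h1 h2
    zify at h1 h2 hgh
    have h3 : ((x' : ℤ) - x - g) * p + (y' - y - h) * q = -(p * q) := by
      linear_combination h2 - h1 - hgh
    have hpq' : IsCoprime (p : ℤ) q := Nat.isCoprime_iff_coprime.2 hpq
    obtain ⟨t, ht⟩ : (p : ℤ) ∣ y' - y - h :=
      hpq'.dvd_of_dvd_mul_right ⟨-q - (x' - x - g), by linear_combination h3⟩
    obtain ⟨s, hs⟩ : (q : ℤ) ∣ x' - x - g :=
      hpq'.symm.dvd_of_dvd_mul_right ⟨-p - (y' - y - h), by linear_combination h3⟩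
    refine ⟨s, t, hs, ht, ?_⟩
    rw [hs, ht] at h3
    have hM : (p * q : ℤ) ≠ 0 := by positivity
    apply mul_left_cancel₀ hM
    linear_combination h3
  by_cases hi : i + 1 < p * q
  swap
  · rw [binaryCoeff.eq_def p q g h (i + 1), if_neg hi, mul_zero]
  have hi' : i < p * q := by omega
  have hlow := fun j hj => mul_mod_add_mul_mod_eq_of_lt (i := j) hp hq hpq hgh hj
  have hhigh := fun j hj => mul_mod_add_mul_mod_eq_of_le (i := j) hp hq hpq hgh hj
  have l1 := hlow i hi'
  have l2 := hlow (i + 1) hi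
  have u1 := hhigh i hi'
  have u2 := hhigh (i + 1) hi
  have hx1 := Nat.mod_lt (i * g) hq
  have hx2 := Nat.mod_lt ((i + 1) * g) hq
  have hy1 := Nat.mod_lt (i * h) hp
  have hy2 := Nat.mod_lt ((i + 1) * h) hp
  unfold binaryCoeff
  rw [if_pos hi, if_pos hi']
  generalize i * g % q = x at *
  generalize i * h % p = y at *
  generalize (i + 1) * g % q = x' at *
  generalize (i + 1) * h % p = y' at *
  split_ifs with c1 c2 c3 c4 c5 c6 <;> norm_num
  · obtain ⟨s, t, hs, ht, hst⟩ := key x y x' y' 0 (l1 c1.1 c1.2) (l2 c2.1 c2.2)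
    have : s < 0 := by by_contra hc; push Not at hc; nlinarith
    have : t < 0 := by by_contra hc; push Not at hc; nlinarith
    omega
  · obtain ⟨s, t, hs, ht, hst⟩ := key x y x' y' (p * q) (u1 c4.1 c4.2) (u2 c6.1 c6.2)
    have : -1 < s := by by_contra hc; push Not at hc; nlinarith
    have : -1 < t := by by_contra hc; push Not at hc; nlinarith
    omega

lemma exists_eq_of_abs_succ_sub_le_one {b : ℕ → ℤ} (hb : ∀ n, |b (n + 1) - b n| ≤ 1) {v : ℤ}
    {i j : ℕ} (hi : b i ≤ v) (hj : v ≤ b j) : ∃ n, b n = v := by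
  by_contra hv
  push Not at hv
  have up : ∀ n, b n < v ↔ b (n + 1) < v := by
    intro n
    have h1 := abs_le.1 (hb n)
    have h2 := hv n
    have h3 := hv (n + 1)
    omega
  have all : ∀ n, b n < v ↔ b 0 < v := by
    intro n
    induction n with
    | zero => rfl
    | succ n ih => rw [← up, ih]
  have h1 : b i < v := lt_of_le_of_ne hi (hv i)
  have h2 := (all j).2 ((all i).1 h1)
  omega

lemma exists_eq_of_mul_nonpos {b : ℕ → ℤ} (hb : ∀ n, |b (n + 1) - b n| ≤ 1) {v s t : ℤ}
    (hst : s * t ≤ 0) {i j : ℕ} (hi : b i = v + s) (hj : b j = v + t) : ∃ n, b n = v := by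
  rcases mul_nonpos_iff.1 hst with h | h
  · exact exists_eq_of_abs_succ_sub_le_one hb (i := j) (j := i) (by omega) (by omega)
  · exact exists_eq_of_abs_succ_sub_le_one hb (i := i) (j := j) (by omega) (by omega)

lemma truncatedConv_succ (r : ℤ) (N : ℕ) (m : ℤ) :
    truncatedConv p q g h r (N + 1) m =
      truncatedConv p q g h r N m + binaryCoeff p q g h N * periodicCoeff p q (m - r * N) :=
  sum_range_succ _ _

section Realization

variable {r : ℕ}

lemma truncatedConv_eq_zero_of_eq (hpltq : p < q) (hlt : p + q < p * q) (hpr : p < r) :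
    truncatedConv p q g h r (p / r + 1) (p : ℕ) = 0 := by
  have h1 : periodicCoeff p q p = 0 := by
    have : (p : ℤ) % (p * q : ℤ) = p :=
      Int.emod_eq_of_lt (by positivity) (by exact_mod_cast (by omega : p < p * q))
    unfold periodicCoeff
    rw [this]
    split_ifs <;> omega
  rw [Nat.div_eq_of_lt hpr, truncatedConv_succ]
  simp [truncatedConv, h1]

lemma abs_diagonal_succ_sub_le (hp : 0 < p) (hpltq : p < q) (hlt : p + q < p * q)
    (hpq : Nat.Coprime p q) (hgh : g * p + h * q = p * q + 1)
    (hr : IsCoprime (r : ℤ) (p * q : ℤ)) (n : ℕ) :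
    |truncatedConv p q g h r ((n + 1) / r + 1) ((n + 1 : ℕ) : ℤ) -
      truncatedConv p q g h r (n / r + 1) n| ≤ 1 := by
  have hlt' : (p : ℤ) + q < p * q := by exact_mod_cast hlt
  have h1 : truncatedConv p q g h r (n / r + 1) n =
      truncatedConv p q g h r ((n + 1) / r + 1) n := by
    rw [Nat.succ_div]
    split_ifs with hd
    · rw [truncatedConv_succ _ (n / r + 1)]
      have h2 : (n / r + 1) * r = n + 1 := by
        have := Nat.div_mul_cancel hd
        rwa [Nat.succ_div, if_pos hd] at this
      have h3 : (n : ℤ) - r * ((n / r + 1 : ℕ) : ℤ) = -1 := by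
        have : (((n / r + 1) * r : ℕ) : ℤ) = n + 1 := by exact_mod_cast h2
        push_cast at this ⊢
        linarith
      have h4 : periodicCoeff p q (-1) = 0 := by
        have : (-1 : ℤ) % (p * q : ℤ) = p * q - 1 := by
          rw [← Int.add_emod_right, Int.emod_eq_of_lt (by omega) (by omega)]
          ring
        unfold periodicCoeff
        rw [this]
        generalize (p * q : ℤ) = M at *
        split_ifs <;> omega
      rw [h3, h4, mul_zero, add_zero]
    · rfl
  rw [h1]
  push_cast
  exact abs_truncatedConv_add_one_sub_le hp hpltq hlt hpq hgh hr _ _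

lemma truncatedConv_emod_shift (r : ℤ) (N k : ℕ) (m : ℤ) :
    truncatedConv p q g h r N (r * k + (m - r * k) % (p * q : ℤ)) =
      truncatedConv p q g h r N m := by
  refine truncatedConv_congr (Int.ModEq.refl r) ?_ N
  have := (Int.mod_modEq (m - r * k) (p * q : ℤ)).add_left (r * k)
  rwa [add_sub_cancel] at this

/-- Every value of `truncatedConv` is attained on the diagonal `N = n / r + 1`. -/
lemma exists_diagonal_eq (hp : 0 < p) (hpltq : p < q) (hlt : p + q < p * q)
    (hpq : Nat.Coprime p q) (hgh : g * p + h * q = p * q + 1)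
    (hr : IsCoprime (r : ℤ) (p * q : ℤ)) (hqr : q < r) (N : ℕ) (m : ℤ) :
    ∃ n : ℕ, truncatedConv p q g h r (n / r + 1) n = truncatedConv p q g h r N m := by
  have hr0 : 0 < r := by omega
  have hlt' : (p : ℤ) + q < p * q := by exact_mod_cast hlt
  induction N with
  | zero => exact ⟨p, truncatedConv_eq_zero_of_eq hpltq hlt (hpltq.trans hqr)⟩
  | succ N ih =>
    obtain ⟨u, hu⟩ := Int.eq_ofNat_of_zero_le
      (Int.emod_nonneg (m - r * N) (by omega : (p * q : ℤ) ≠ 0))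
    have hshift := fun K => truncatedConv_emod_shift (p := p) (q := q) (g := g) (h := h) r K N m
    rw [hu] at hshift
    have hc : periodicCoeff p q (m - r * N) =
        if u < p then 1 else if q ≤ u ∧ u < q + p then -1 else 0 := by
      unfold periodicCoeff
      rw [hu]
      norm_cast
    have hdiag : ∀ K, (r * N + u) / r + 1 = K →
        ∃ n : ℕ, truncatedConv p q g h r (n / r + 1) n = truncatedConv p q g h r K m := by
      rintro K rfl
      refine ⟨r * N + u, ?_⟩
      rw [← hshift]
      push_cast
      rfl
    rcases lt_or_ge u r with hur | hur
    · by_cases hcu : u < p ∨ q ≤ u ∧ u < q + p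
      · refine hdiag _ ?_
        rw [Nat.mul_add_div hr0, Nat.div_eq_of_lt hur, add_zero]
      · rw [if_neg (by tauto), if_neg (by tauto)] at hc
        rw [truncatedConv_succ, hc, mul_zero, add_zero]
        exact ih
    · by_cases hcu : u < q + p
      · rw [if_neg (by omega), if_pos ⟨by omega, hcu⟩] at hc
        have hdiv : (r * N + u) / r + 1 = N + 1 + 1 := by
          rw [Nat.mul_add_div hr0, Nat.div_eq_of_lt_le (k := 1) (by omega) (by omega)]
        obtain ⟨i, hi⟩ := ih
        obtain ⟨j, hj⟩ := hdiag _ hdiv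
        have hc' : periodicCoeff p q (m - r * ((N + 1 : ℕ) : ℤ)) = 1 := by
          have e : (m - r * ((N + 1 : ℕ) : ℤ)) % (p * q : ℤ) = u - r := by
            rw [show m - r * ((N + 1 : ℕ) : ℤ) = m - r * N - r by push_cast; ring,
              ← Int.emod_sub_emod, hu, Int.emod_eq_of_lt (by omega) (by omega)]
          unfold periodicCoeff
          rw [e, if_pos (by omega)]
        have s1 := truncatedConv_succ (p := p) (q := q) (g := g) (h := h) r N m
        rw [hc, mul_neg_one] at s1
        rw [truncatedConv_succ r (N + 1), hc', mul_one] at hj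
        exact exists_eq_of_mul_nonpos
          (b := fun n : ℕ => truncatedConv p q g h r (n / r + 1) n)
          (abs_diagonal_succ_sub_le hp hpltq hlt hpq hgh hr)
          (binaryCoeff_mul_succ_nonpos hp (hp.trans hpltq) hpq hgh N)
          (hi.trans (by rw [s1]; ring)) hj
      · rw [if_neg (by omega), if_neg (by omega)] at hc
        rw [truncatedConv_succ, hc, mul_zero, add_zero]
        exact ih

end Realization

lemma coeffSet_eq_range {f : ℤ[X]} {n : ℕ} (hn : n ≤ f.natDegree) (h0 : f.coeff n = 0) :
    coeffSet f = Set.range f.coeff := by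
  ext c
  constructor
  · rintro ⟨j, _, rfl⟩
    exact ⟨j, rfl⟩
  · rintro ⟨j, rfl⟩
    rcases le_or_gt j f.natDegree with hj | hj
    · exact ⟨j, hj, rfl⟩
    · exact ⟨n, hn, by rw [h0, coeff_eq_zero_of_natDegree_lt hj]⟩

lemma le_natDegree_unitaryCyclotomic {r : ℕ} (hp : IsPrimePow p) (hq : IsPrimePow q)
    (hr : IsPrimePow r) (hpq : Nat.Coprime p q) (hpr : Nat.Coprime p r) (hqr : Nat.Coprime q r)
    (hp3 : 3 ≤ p) (hq3 : 3 ≤ q) (hr3 : 3 ≤ r) :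
    p ≤ (unitaryCyclotomic (p * q * r)).natDegree := by
  have hX : ∀ k : ℕ, 0 < k → (X ^ k - 1 : ℤ[X]) ≠ 0 := fun k hk => X_pow_sub_C_ne_zero hk 1
  have hdeg : ∀ k : ℕ, (X ^ k - 1 : ℤ[X]).natDegree = k := fun k => natDegree_X_pow_sub_C
  have h1 := unitaryCyclotomic_mul_eq hp hq hr hpq hpr hqr
  rw [show (X - 1 : ℤ[X]) = X ^ 1 - 1 by rw [pow_one]] at h1
  have n1 := hX 1 one_pos
  have n2 := hX (p * q) (by positivity)
  have n3 := hX (p * r) (by positivity)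
  have n4 := hX (q * r) (by positivity)
  have n5 := hX (p * q * r) (by positivity)
  have n6 := hX p (by positivity)
  have n7 := hX q (by positivity)
  have n8 := hX r (by positivity)
  have hR := mul_ne_zero (mul_ne_zero (mul_ne_zero n5 n6) n7) n8
  have hU : unitaryCyclotomic (p * q * r) ≠ 0 := by
    intro h
    rw [h, zero_mul] at h1
    exact hR h1.symm
  have h2 := congrArg natDegree h1
  rw [natDegree_mul hU (mul_ne_zero (mul_ne_zero (mul_ne_zero n1 n2) n3) n4),
    natDegree_mul (mul_ne_zero (mul_ne_zero n1 n2) n3) n4, natDegree_mul (mul_ne_zero n1 n2) n3,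
    natDegree_mul n1 n2, natDegree_mul (mul_ne_zero (mul_ne_zero n5 n6) n7) n8,
    natDegree_mul (mul_ne_zero n5 n6) n7, natDegree_mul n5 n6] at h2
  simp only [hdeg] at h2
  obtain ⟨a, rfl⟩ := Nat.exists_eq_add_of_le hp3
  obtain ⟨b, rfl⟩ := Nat.exists_eq_add_of_le hq3
  obtain ⟨c, rfl⟩ := Nat.exists_eq_add_of_le hr3
  have : 0 ≤ a * b * c := Nat.zero_le _
  nlinarith

lemma coeffSet_unitaryCyclotomic_eq {r : ℕ} (hp : IsPrimePow p) (hq : IsPrimePow q)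
    (hr : IsPrimePow r) (hp3 : 3 ≤ p) (hpltq : p < q) (hqltr : q < r) (hpq : Nat.Coprime p q)
    (hpr : Nat.Coprime p r) (hqr : Nat.Coprime q r) (hlt : p + q < p * q) (hgq : g ≤ q)
    (hhp : h ≤ p) (hgh : g * p + h * q = p * q + 1) :
    coeffSet (unitaryCyclotomic (p * q * r)) =
      {c | ∃ N m, truncatedConv p q g h r N m = c} := by
  have hcoeff := coeff_unitaryCyclotomic hp hq hr hpq hpr hqr hpltq hlt.le hgq hhp hgh
  rw [coeffSet_eq_range (le_natDegree_unitaryCyclotomic hp hq hr hpq hpr hqr hp3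
    (by omega) (by omega))
    ((hcoeff p).trans (truncatedConv_eq_zero_of_eq hpltq hlt (hpltq.trans hqltr)))]
  have hcop : IsCoprime (r : ℤ) (p * q : ℤ) := by
    exact_mod_cast Nat.isCoprime_iff_coprime.2 (Nat.Coprime.mul_right hpr.symm hqr.symm)
  ext c
  constructor
  · rintro ⟨n, rfl⟩
    exact ⟨_, _, (hcoeff n).symm⟩
  · rintro ⟨N, m, rfl⟩
    obtain ⟨n, hn⟩ := exists_diagonal_eq hp.pos hpltq hlt hpq hgh hcop hqltr N m
    exact ⟨n, (hcoeff n).trans hn⟩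

lemma coeffSet_unitaryCyclotomic_congruent_of_lt {r s : ℕ} (hp : IsPrimePow p)
    (hq : IsPrimePow q) (hr : IsPrimePow r) (hs : IsPrimePow s) (hp3 : 3 ≤ p)
    (hpq : Nat.Coprime p q) (hpr : Nat.Coprime p r) (hps : Nat.Coprime p s)
    (hqr : Nat.Coprime q r) (hqs : Nat.Coprime q s) (hpltq : p < q) (hqltr : q < r)
    (hqlts : q < s) :
    (Int.ModEq (p * q : ℤ) (r : ℤ) (s : ℤ) →
      coeffSet (unitaryCyclotomic (p * q * r)) = coeffSet (unitaryCyclotomic (p * q * s))) ∧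
    (Int.ModEq (p * q : ℤ) (r : ℤ) (-(s : ℤ)) →
      coeffSet (unitaryCyclotomic (p * q * r)) =
        (fun c : ℤ => -c) '' coeffSet (unitaryCyclotomic (p * q * s))) := by
  have hlt : p + q < p * q := by nlinarith
  obtain ⟨g, h, hgq, hhp, hgh⟩ := exists_mul_add_mul_eq hp3 (hp3.trans hpltq.le) hpq
  rw [coeffSet_unitaryCyclotomic_eq hp hq hr hp3 hpltq hqltr hpq hpr hqr hlt hgq.le hhp.le hgh,
    coeffSet_unitaryCyclotomic_eq hp hq hs hp3 hpltq hqlts hpq hps hqs hlt hgq.le hhp.le hgh]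
  constructor
  · intro hrs
    simp only [truncatedConv_congr hrs (Int.ModEq.refl _)]
  · intro hrs
    ext c
    constructor
    · rintro ⟨N, m, rfl⟩
      exact ⟨_, ⟨N, p + q - 1 - m, rfl⟩, (truncatedConv_reflect hpltq hlt.le hrs N m).symm⟩
    · rintro ⟨_, ⟨N, m, rfl⟩, rfl⟩
      refine ⟨N, p + q - 1 - m, ?_⟩
      rw [truncatedConv_reflect hpltq hlt.le hrs, sub_sub_cancel]

end Combinatorics

/-- For four pairwise coprime prime powers `p, q, r, s ≥ 3` with `r, s > max(p, q)`:
if `r ≡ s (mod pq)` then `C(Φ*_{pqr}) = C(Φ*_{pqs})`, and if `r ≡ −s (mod pq)` then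
`C(Φ*_{pqr}) = −C(Φ*_{pqs})`. -/
theorem coeffSet_unitaryCyclotomic_congruent (p q r s : ℕ)
    (hp : IsPrimePow p) (hq : IsPrimePow q) (hr : IsPrimePow r) (hs : IsPrimePow s)
    (hp3 : 3 ≤ p) (hq3 : 3 ≤ q) (hr3 : 3 ≤ r) (hs3 : 3 ≤ s)
    (hpq : Nat.Coprime p q) (hpr : Nat.Coprime p r) (hps : Nat.Coprime p s)
    (hqr : Nat.Coprime q r) (hqs : Nat.Coprime q s) (hrs : Nat.Coprime r s)
    (hrmax : max p q < r) (hsmax : max p q < s) :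
    (Int.ModEq (p * q : ℤ) (r : ℤ) (s : ℤ) →
      coeffSet (unitaryCyclotomic (p * q * r)) = coeffSet (unitaryCyclotomic (p * q * s))) ∧
    (Int.ModEq (p * q : ℤ) (r : ℤ) (-(s : ℤ)) →
      coeffSet (unitaryCyclotomic (p * q * r)) =
        (fun c : ℤ => -c) '' coeffSet (unitaryCyclotomic (p * q * s))) := by
  rcases lt_trichotomy p q with hlt | rfl | hlt
  · exact coeffSet_unitaryCyclotomic_congruent_of_lt hp hq hr hs hp3 hpq hpr hps hqr hqs hlt
      (by omega) (by omega)
  · have := (Nat.coprime_self p).1 hpq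
    omega
  · rw [mul_comm p q, mul_comm (p : ℤ) q]
    exact coeffSet_unitaryCyclotomic_congruent_of_lt hq hp hr hs hq3 hpq.symm hqr hqs hpr hps hlt
      (by omega) (by omega)
end

section
/- Let p, q, r, s ≥ 3 be four pairwise coprime prime powers with r ≡ s (mod pq) or r ≡ −s (mod pq), and with r > max(p, q) > s ≥ 3. Then H(Φ*_{pqs}) ≤ H(Φ*_{pqr}) ≤ H(Φ*_{pqs}) + 1, where H(f) denotes the maximum of the absolute values of the coefficients of f. -/
open Polynomial

/-- The height of a polynomial: the maximum of the absolute values of its coefficients. -/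
noncomputable def polyHeight (f : Polynomial ℤ) : ℕ :=
  (Finset.range (f.natDegree + 1)).sup fun j => (f.coeff j).natAbs

theorem expand_prime_pow_cyclotomic {l d : ℕ} (hl : l.Prime) (hd : ¬ l ∣ d) (k : ℕ) :
    expand ℤ (l ^ k) (cyclotomic d ℤ) =
      cyclotomic d ℤ * ∏ j ∈ Finset.range k, cyclotomic (d * l ^ (j + 1)) ℤ := by
  induction k with
  | zero => simp
  | succ k ih =>
    rw [pow_succ', ← expand_expand, ih, map_mul, map_prod, Finset.prod_range_succ']
    rw [cyclotomic_expand_eq_cyclotomic_mul hl hd]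
    have h : ∀ j, expand ℤ l (cyclotomic (d * l ^ (j + 1)) ℤ) =
        cyclotomic (d * l ^ (j + 1 + 1)) ℤ := fun j => by
      rw [cyclotomic_expand_eq_cyclotomic hl (Dvd.intro_left (d * l ^ j) (by ring))]
      congr 1
      ring
    simp only [h, zero_add, pow_one]
    ring

theorem unitaryCyclotomic_mul_isPrimePow {n r : ℕ} (hn : n ≠ 0) (hr : IsPrimePow r)
    (h : n.Coprime r) :
    unitaryCyclotomic (n * r) * unitaryCyclotomic n = expand ℤ r (unitaryCyclotomic n) := by
  obtain ⟨l, k, hl, hk, rfl⟩ := (isPrimePow_nat_iff r).1 hr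
  have hln : ¬ l ∣ n := fun hd => hl.one_lt.ne'
    (Nat.eq_one_of_dvd_coprimes h hd (dvd_pow_self l hk.ne'))
  have hpf : (n * l ^ k).primeFactors = n.primeFactors ∪ {l} := by
    rw [Nat.primeFactors_mul hn (pow_ne_zero _ hl.ne_zero),
      Nat.primeFactors_prime_pow hk.ne' hl]
  have hlpf : l ∉ n.primeFactors := fun hm => hln (Nat.dvd_of_mem_primeFactors hm)
  have hnl : ∀ {d}, d ∣ n → ¬ l ∣ d := fun hd hl => hln (hl.trans hd)
  unfold unitaryCyclotomic
  rw [map_prod, Finset.prod_congr rfl fun d hd => expand_prime_pow_cyclotomic hl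
    (hnl (Nat.dvd_of_mem_divisors (Finset.mem_filter.1 hd).1)) k]
  rw [Finset.prod_mul_distrib, mul_comm, ← Finset.prod_product']
  congr 1
  symm
  refine Finset.prod_nbij (fun x => x.1 * l ^ (x.2 + 1)) ?_ ?_ ?_ fun _ _ => rfl
  · rintro ⟨d, j⟩ hx
    simp only [Finset.mem_product, Finset.mem_filter, Nat.mem_divisors, Finset.mem_range] at hx ⊢
    obtain ⟨⟨⟨hd, -⟩, hd'⟩, hj⟩ := hx
    refine ⟨⟨mul_dvd_mul hd (pow_dvd_pow l (by lia)),
      mul_ne_zero hn (pow_ne_zero _ hl.ne_zero)⟩, ?_⟩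
    rw [hpf, Nat.primeFactors_mul (ne_zero_of_dvd_ne_zero hn hd) (pow_ne_zero _ hl.ne_zero),
      Nat.primeFactors_prime_pow (by lia) hl, hd']
  · rintro ⟨d, j⟩ hx ⟨d', j'⟩ hx' he
    simp only [Finset.coe_product, Set.mem_prod, Finset.mem_coe, Finset.mem_filter,
      Nat.mem_divisors] at hx hx' he
    have hc : ∀ {d d' i : ℕ}, d ∣ n → d ∣ d' * l ^ i → d ∣ d' := fun hd hd' =>
      (((hl.coprime_iff_not_dvd.2 (hnl hd)).symm).pow_right _).dvd_of_dvd_mul_right hd'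
    obtain rfl : d = d' := Nat.dvd_antisymm
      (hc hx.1.1.1 (he ▸ Dvd.intro _ rfl)) (hc hx'.1.1.1 (he.symm ▸ Dvd.intro _ rfl))
    have hd0 : 0 < d := Nat.pos_of_dvd_of_pos hx.1.1.1 (Nat.pos_of_ne_zero hn)
    have := Nat.pow_right_injective hl.two_le (Nat.eq_of_mul_eq_mul_left hd0 he)
    simp_all
  · intro e he
    simp only [Finset.coe_filter, Nat.mem_divisors, Set.mem_ofPred_eq] at he
    obtain ⟨⟨hd, -⟩, hp⟩ := he
    obtain ⟨d, y, hdn, hy, rfl⟩ := (Nat.dvd_mul.1 hd)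
    obtain ⟨j, hj, rfl⟩ := (Nat.dvd_prime_pow hl).1 hy
    have hd0 : d ≠ 0 := ne_zero_of_dvd_ne_zero hn hdn
    have hld : l ∉ d.primeFactors := fun hm => hnl hdn (Nat.dvd_of_mem_primeFactors hm)
    rcases j with _ | j
    · rw [hpf, pow_zero, mul_one] at hp
      exact absurd (hp ▸ Finset.mem_union_right _ (Finset.mem_singleton_self l)) hld
    · refine ⟨(d, j), ?_, rfl⟩
      rw [hpf, Nat.primeFactors_mul hd0 (pow_ne_zero _ hl.ne_zero),
        Nat.primeFactors_prime_pow (by lia) hl] at hp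
      have hp' : d.primeFactors = n.primeFactors := by
        ext x
        have := Finset.ext_iff.1 hp x
        simp only [Finset.mem_union, Finset.mem_singleton] at this
        by_cases hx : x = l
        · subst hx; tauto
        · tauto
      simp [hdn, hn, hp', Nat.lt_of_succ_le hj]

theorem unitaryCyclotomic_one : unitaryCyclotomic 1 = X - 1 := by
  simp [unitaryCyclotomic, Finset.filter_singleton]

theorem unitaryCyclotomic_isPrimePow_mul {q : ℕ} (hq : IsPrimePow q) :
    unitaryCyclotomic q * (X - 1) = X ^ q - 1 := by
  simpa [unitaryCyclotomic_one] using unitaryCyclotomic_mul_isPrimePow one_ne_zero hq (by simp)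

theorem unitaryCyclotomic_binary {p q : ℕ} (hp : IsPrimePow p) (hq : IsPrimePow q)
    (hpq : p.Coprime q) :
    unitaryCyclotomic (p * q) * ((X ^ p - 1) * (X ^ q - 1)) = (X ^ (p * q) - 1) * (X - 1) := by
  have h1 := unitaryCyclotomic_mul_isPrimePow hp.pos.ne' hq hpq
  have h2 := unitaryCyclotomic_isPrimePow_mul hp
  have h3 := congrArg (expand ℤ q) h2
  simp only [map_mul, map_sub, map_pow, expand_X, map_one, ← pow_mul] at h3
  rw [← h1, mul_comm q p] at h3
  rw [← h2, ← h3]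
  ring

theorem natAbs_coeff_le_polyHeight (f : ℤ[X]) (n : ℕ) : (f.coeff n).natAbs ≤ polyHeight f := by
  by_cases h : n ≤ f.natDegree
  · exact Finset.le_sup (f := fun j => (f.coeff j).natAbs) (Finset.mem_range.2 (by lia))
  · simp [coeff_eq_zero_of_natDegree_lt (not_le.1 h)]

theorem polyHeight_le {f : ℤ[X]} {B : ℕ} (h : ∀ n, (f.coeff n).natAbs ≤ B) :
    polyHeight f ≤ B :=
  Finset.sup_le fun n _ => h n

/-- The difference of the indicator functions of `[0, p)` and `[q, p + q)`. -/
def blockDiff (p q : ℕ) (z : ℤ) : ℤ :=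
  (if 0 ≤ z ∧ z < p then 1 else 0) - if (q : ℤ) ≤ z ∧ z < p + q then 1 else 0

/-- The coefficients of the power series `(1 - X ^ p) (1 - X ^ q) / ((1 - X ^ (p q)) (1 - X))`,
extended periodically to `ℤ`. -/
def invBinaryCoeff (p q : ℕ) (z : ℤ) : ℤ := blockDiff p q (z % (p * q : ℤ))

theorem mk_blockDiff_mul (p q : ℕ) :
    PowerSeries.mk (fun n => blockDiff p q n) * (PowerSeries.X - 1) =
      (-(PowerSeries.X ^ p - 1) * (PowerSeries.X ^ q - 1) : PowerSeries ℤ) := by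
  have h : PowerSeries.mk (fun n => blockDiff p q n) =
      ((∑ j ∈ Finset.range p, PowerSeries.X ^ j) * (1 - PowerSeries.X ^ q) : PowerSeries ℤ) := by
    ext n
    rw [mul_one_sub]
    simp only [PowerSeries.coeff_mk, map_sub, PowerSeries.coeff_mul_X_pow', map_sum,
      PowerSeries.coeff_X_pow, Finset.sum_ite_eq, Finset.mem_range, blockDiff]
    split_ifs <;> lia
  rw [h, mul_right_comm, geom_sum_mul]
  ring

theorem mk_invBinaryCoeff_mul {p q : ℕ} (h : p + q ≤ p * q) :
    PowerSeries.mk (fun n => invBinaryCoeff p q n) *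
      ((PowerSeries.X ^ (p * q) - 1) * (PowerSeries.X - 1)) =
      ((PowerSeries.X ^ p - 1) * (PowerSeries.X ^ q - 1) : PowerSeries ℤ) := by
  have h1 : PowerSeries.mk (fun n => invBinaryCoeff p q n) * (1 - PowerSeries.X ^ (p * q)) =
      (PowerSeries.mk (fun n => blockDiff p q n) : PowerSeries ℤ) := by
    ext n
    rw [mul_one_sub]
    simp only [PowerSeries.coeff_mk, map_sub, PowerSeries.coeff_mul_X_pow', invBinaryCoeff]
    split_ifs with hn
    · rw [Nat.cast_sub hn, Nat.cast_mul, Int.sub_emod_right, sub_self]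
      have : ((p + q : ℕ) : ℤ) ≤ (p * q : ℕ) := by exact_mod_cast h
      simp only [blockDiff]
      split_ifs <;> lia
    · rw [Int.emod_eq_of_lt (by positivity) (by exact_mod_cast not_le.1 hn), sub_zero]
  linear_combination -mk_blockDiff_mul p q - (PowerSeries.X - 1) * h1

theorem coeff_unitaryCyclotomic_ternary {p q r : ℕ} (hp : IsPrimePow p) (hq : IsPrimePow q)
    (hr : IsPrimePow r) (hpq : p.Coprime q) (hpr : p.Coprime r) (hqr : q.Coprime r)
    (h : p + q ≤ p * q) (n : ℕ) :
    (unitaryCyclotomic (p * q * r)).coeff n =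
      ∑ m ∈ Finset.range (n / r + 1),
        (unitaryCyclotomic (p * q)).coeff m * invBinaryCoeff p q (n - r * m) := by
  have hpq0 : p * q ≠ 0 := mul_ne_zero hp.pos.ne' hq.pos.ne'
  have h1 := unitaryCyclotomic_mul_isPrimePow hpq0 hr (Nat.Coprime.mul_left hpr hqr)
  have h2 := congrArg (fun f : ℤ[X] => (f : PowerSeries ℤ)) (unitaryCyclotomic_binary hp hq hpq)
  simp only [coe_mul, coe_sub, coe_pow, coe_X, coe_one] at h2
  have h3 := mk_invBinaryCoeff_mul h
  set Z : PowerSeries ℤ := PowerSeries.mk fun n => invBinaryCoeff p q n with hZ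
  have hE : ((PowerSeries.X ^ (p * q) - 1) * (PowerSeries.X - 1) : PowerSeries ℤ) ≠ 0 := by
    intro h0
    have h4 : ((X ^ (p * q) - 1) * (X - 1) : ℤ[X]) = 0 := by
      rw [← coe_inj (R := ℤ)]
      simpa only [coe_mul, coe_sub, coe_pow, coe_X, coe_one, coe_zero] using h0
    rcases mul_eq_zero.1 h4 with h4 | h4
    · exact (X_pow_sub_C_ne_zero (Nat.pos_of_ne_zero hpq0) (1 : ℤ)) (by simpa using h4)
    · exact (X_sub_C_ne_zero (1 : ℤ)) (by simpa using h4)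
  have h5 : (unitaryCyclotomic (p * q) : PowerSeries ℤ) * Z = 1 := by
    apply mul_right_cancel₀ hE
    rw [mul_assoc, h3, h2, one_mul]
  have h6 : (unitaryCyclotomic (p * q * r) : PowerSeries ℤ) =
      (expand ℤ r (unitaryCyclotomic (p * q)) : ℤ[X]) * Z := by
    rw [← h1, coe_mul, mul_assoc (unitaryCyclotomic (p * q * r) : PowerSeries ℤ), h5, mul_one]
  rw [← coeff_coe, h6, PowerSeries.coeff_mul,
    Finset.Nat.sum_antidiagonal_eq_sum_range_succ
      (fun i j => PowerSeries.coeff i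
        ((expand ℤ r (unitaryCyclotomic (p * q)) : ℤ[X]) : PowerSeries ℤ) *
          PowerSeries.coeff j Z)]
  symm
  refine Finset.sum_of_injOn (fun m => r * m) ?_ ?_ ?_ ?_
  · exact fun a _ b _ hab => Nat.eq_of_mul_eq_mul_left hr.pos hab
  · intro m hm
    simp only [Finset.coe_range, Set.mem_Iio, Nat.lt_succ_iff] at hm ⊢
    rw [Nat.le_div_iff_mul_le hr.pos] at hm
    rwa [mul_comm]
  · intro i hi hi'
    rw [coeff_coe, coeff_expand hr.pos, if_neg, zero_mul]
    rintro ⟨m, rfl⟩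
    refine hi' ⟨m, ?_, rfl⟩
    simp only [Finset.coe_range, Set.mem_Iio, Finset.mem_range, Nat.lt_succ_iff] at hi ⊢
    rwa [Nat.le_div_iff_mul_le hr.pos, mul_comm]
  · intro m hm
    simp only [Finset.mem_range, Nat.lt_succ_iff] at hm
    rw [Nat.le_div_iff_mul_le hr.pos, mul_comm] at hm
    rw [coeff_coe, coeff_expand_mul' hr.pos, hZ, PowerSeries.coeff_mk]
    push_cast [hm]
    rfl

theorem sum_coeff_unitaryCyclotomic_binary {p q : ℕ} (hp : IsPrimePow p) (hq : IsPrimePow q)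
    (hpq : p.Coprime q) (n : ℕ) :
    ∑ m ∈ Finset.range n, (unitaryCyclotomic (p * q)).coeff m = 0 ∨
    ∑ m ∈ Finset.range n, (unitaryCyclotomic (p * q)).coeff m = 1 := by
  rcases n with _ | n
  · simp
  have h1 : unitaryCyclotomic (p * q) * (X ^ q - 1) =
      (∑ i ∈ Finset.range q, (X ^ p) ^ i) * (X - 1) := by
    apply mul_right_cancel₀ (X_pow_sub_C_ne_zero hp.pos (1 : ℤ))
    rw [map_one, mul_right_comm _ (X - 1 : ℤ[X]), geom_sum_mul, ← pow_mul,
      ← unitaryCyclotomic_binary hp hq hpq]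
    ring
  have h2 := congrArg (fun f : ℤ[X] => (f : PowerSeries ℤ)) h1
  simp only [coe_mul, coe_sub, coe_pow, coe_X, coe_one] at h2
  set V : PowerSeries ℤ := PowerSeries.mk fun n => if q ∣ n then 1 else 0 with hV
  have hVq : V * (1 - PowerSeries.X ^ q) = 1 := by
    ext n
    rw [mul_one_sub]
    simp only [hV, PowerSeries.coeff_mk, map_sub, PowerSeries.coeff_mul_X_pow',
      PowerSeries.coeff_one]
    rcases lt_or_ge n q with hn | hn
    · rw [if_neg hn.not_ge, sub_zero]
      exact if_congr ⟨fun h => Nat.eq_zero_of_dvd_of_lt h hn, fun h => h ▸ dvd_zero q⟩ rfl rfl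
    · rw [if_pos hn, if_neg (hq.pos.trans_le hn).ne', sub_eq_zero]
      exact if_congr (Nat.dvd_sub_iff_left hn dvd_rfl).symm rfl rfl
  have h3 : (unitaryCyclotomic (p * q) : PowerSeries ℤ) * PowerSeries.mk 1 =
      ((∑ i ∈ Finset.range q, X ^ (p * i) : ℤ[X]) : PowerSeries ℤ) * V := by
    have h4 := PowerSeries.mk_one_mul_one_sub_eq_one ℤ
    simp only [pow_mul]
    linear_combination (-V * PowerSeries.mk 1) * h2 -
      (unitaryCyclotomic (p * q) : PowerSeries ℤ) * PowerSeries.mk 1 * hVq +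
      ((∑ i ∈ Finset.range q, (X ^ p) ^ i : ℤ[X]) : PowerSeries ℤ) * V * h4
  have h5 := congrArg (PowerSeries.coeff n) h3
  rw [PowerSeries.coeff_mul, Finset.Nat.sum_antidiagonal_eq_sum_range_succ_mk] at h5
  simp only [coeff_coe, PowerSeries.coeff_mk, Pi.one_apply, mul_one] at h5
  rw [h5, ← coeToPowerSeries.ringHom_apply, map_sum, Finset.sum_mul, map_sum]
  simp only [coeToPowerSeries.ringHom_apply, coe_pow, coe_X, PowerSeries.coeff_X_pow_mul', hV,
    PowerSeries.coeff_mk, ← ite_and]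
  rw [Finset.sum_boole]
  have h6 : (Finset.filter (fun i => p * i ≤ n ∧ q ∣ n - p * i) (Finset.range q)).card ≤ 1 := by
    rw [Finset.card_le_one]
    simp only [Finset.mem_filter, Finset.mem_range]
    rintro i ⟨hi, hi', hi''⟩ j ⟨hj, hj', hj''⟩
    have h7 : p * i ≡ p * j [MOD q] :=
      ((Nat.modEq_iff_dvd' hi').2 hi'').trans ((Nat.modEq_iff_dvd' hj').2 hj'').symm
    exact ((Nat.ModEq.cancel_left_of_coprime hpq.symm h7)).eq_of_lt_of_lt hi hj
  lia

/-- The sum `∑_{m < T} a m * χ (i - r m)`. -/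
def truncSum (a : ℕ → ℤ) (χ : ℤ → ℤ) (r : ℕ) (i : ℤ) (T : ℕ) : ℤ :=
  ∑ m ∈ Finset.range T, a m * χ (i - r * m)

theorem abs_sum_Ico_le_one {a : ℕ → ℤ}
    (ha : ∀ n, ∑ m ∈ Finset.range n, a m = 0 ∨ ∑ m ∈ Finset.range n, a m = 1) (A B : ℕ) :
    |∑ m ∈ Finset.Ico A B, a m| ≤ 1 := by
  rcases le_total A B with h | h
  · rw [Finset.sum_Ico_eq_sub _ h, abs_le]
    have := ha A
    have := ha B
    lia
  · simp [Finset.Ico_eq_empty_of_le h]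

theorem abs_sum_Ico_ite_le_one {a : ℕ → ℤ}
    (ha : ∀ n, ∑ m ∈ Finset.range n, a m = 0 ∨ ∑ m ∈ Finset.range n, a m = 1) (A B : ℕ)
    {P : ℕ → Prop} [DecidablePred P] (hP : Monotone P) :
    |∑ m ∈ Finset.Ico A B, if P m then a m else 0| ≤ 1 := by
  rcases le_total B A with h | h
  · simp [Finset.Ico_eq_empty_of_le h]
  induction h using Nat.decreasingInduction with
  | self => simp
  | of_succ k hk ih =>
    by_cases hPk : P k
    · rw [Finset.sum_congr rfl fun m hm => if_pos (hP (Finset.mem_Ico.1 hm).1 hPk)]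
      exact abs_sum_Ico_le_one ha _ _
    · rwa [Finset.sum_eq_sum_Ico_succ_bot hk, if_neg hPk, zero_add]

theorem truncSum_add_mul {p q : ℕ} (a : ℕ → ℤ) (r : ℕ) (i k : ℤ) (T : ℕ) :
    truncSum a (invBinaryCoeff p q) r (i + p * q * k) T =
      truncSum a (invBinaryCoeff p q) r i T := by
  refine Finset.sum_congr rfl fun m _ => ?_
  rw [invBinaryCoeff, invBinaryCoeff, add_sub_right_comm, Int.add_mul_emod_self_left]

theorem truncSum_eq_add_sum_Ico (a : ℕ → ℤ) (χ : ℤ → ℤ) (r : ℕ) (i : ℤ) {S T : ℕ} (h : S ≤ T) :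
    truncSum a χ r i T =
      truncSum a χ r i S + ∑ m ∈ Finset.Ico S T, a m * χ (i - r * m) :=
  (Finset.sum_range_add_sum_Ico _ h).symm

theorem exists_truncSum_residue (p q : ℕ) (h0 : 0 < p * q) (a : ℕ → ℤ) (r : ℕ) (i : ℤ) (t T : ℕ) :
    ∃ u < p * q, truncSum a (invBinaryCoeff p q) r i T =
      truncSum a (invBinaryCoeff p q) r (r * t + u : ℕ) T := by
  have h0' : (0 : ℤ) < p * q := by exact_mod_cast h0
  have h1 := Int.emod_nonneg (i - r * t) h0'.ne'
  have h2 := Int.emod_lt_of_pos (i - r * t) h0'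
  have h3 := Int.mul_ediv_add_emod (i - r * t) (p * q)
  refine ⟨((i - r * t) % (p * q : ℤ)).toNat, by zify; rwa [Int.toNat_of_nonneg h1], ?_⟩
  push_cast
  rw [Int.toNat_of_nonneg h1, 
    ← truncSum_add_mul a r (r * t + _) ((i - r * t) / (p * q))]
  congr 1
  linarith

theorem invBinaryCoeff_of_lt {p q : ℕ} {z : ℤ} (h0 : 0 ≤ z) (h : z < p * q) :
    invBinaryCoeff p q z = blockDiff p q z := by
  rw [invBinaryCoeff, Int.emod_eq_of_lt h0 h]

theorem invBinaryCoeff_reflect {p q : ℕ} (hlt : p < q) (h : p + q ≤ p * q) (z : ℤ) :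
    invBinaryCoeff p q (p + q - 1 - z) = -invBinaryCoeff p q z := by
  have h' : (p + q : ℤ) ≤ p * q := by exact_mod_cast h
  have h0 : (0 : ℤ) < p * q := by lia
  have h1 := Int.emod_nonneg z h0.ne'
  have h2 := Int.emod_lt_of_pos z h0
  have h3 : (p + q - 1 - z) % (p * q : ℤ) = (p + q - 1 - z % (p * q)) % (p * q) := by
    rw [Int.sub_emod_emod]
  simp only [invBinaryCoeff, h3]
  generalize z % (p * q : ℤ) = j at h1 h2
  rcases lt_or_ge j (p + q) with hj | hj
  · rw [Int.emod_eq_of_lt (by lia) (by lia), blockDiff, blockDiff]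
    split_ifs <;> lia
  · rw [← Int.add_emod_right, Int.emod_eq_of_lt (by lia) (by lia), blockDiff, blockDiff]
    split_ifs <;> lia

/-- A truncated sum splits into an actual coefficient (or `0`) and a sum over the terms in one
period. -/
theorem exists_truncSum_split {p q r : ℕ} (hr : 0 < r) (a : ℕ → ℤ) {t u : ℕ} (hu : u < p * q) :
    ∃ S ≤ t + 1, (∀ m, S ≤ m → r * t + u < r * m + p * q) ∧
      (truncSum a (invBinaryCoeff p q) r (r * t + u : ℕ) S = 0 ∨
        ∃ n : ℕ, truncSum a (invBinaryCoeff p q) r (r * t + u : ℕ) S =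
          truncSum a (invBinaryCoeff p q) r n (n / r + 1)) := by
  rcases lt_or_ge (r * t + u) (p * q) with h | h
  · exact ⟨0, Nat.zero_le _, fun m _ => by lia, Or.inl (by simp [truncSum])⟩
  · obtain ⟨n, hn⟩ := Nat.exists_eq_add_of_le' h
    refine ⟨n / r + 1, ?_, fun m hm => ?_, Or.inr ⟨n, ?_⟩⟩
    · have : n / r ≤ t := Nat.div_le_of_le_mul (by lia)
      lia
    · have h1 : n < r * (n / r + 1) := Nat.lt_mul_div_succ n hr
      have h2 : r * (n / r + 1) ≤ r * m := Nat.mul_le_mul_left r hm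
      lia
    · rw [hn, ← truncSum_add_mul a r n 1]
      push_cast
      rw [mul_one]

theorem abs_truncSum_le_of_add_le {p q r : ℕ} (h : 0 < p * q) (hr : 0 < r) (hpqr : p + q ≤ r)
    (a : ℕ → ℤ) {B : ℤ} (hB : 0 ≤ B)
    (hc : ∀ n : ℕ, |truncSum a (invBinaryCoeff p q) r n (n / r + 1)| ≤ B) (i : ℤ) (T : ℕ) :
    |truncSum a (invBinaryCoeff p q) r i T| ≤ B := by
  rcases T with _ | t
  · simpa [truncSum] using hB
  obtain ⟨u, hu, hi⟩ := exists_truncSum_residue p q h a r i t (t + 1)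
  rw [hi]
  rcases lt_or_ge u r with hur | hur
  · have := hc (r * t + u)
    rwa [Nat.mul_add_div hr, Nat.div_eq_of_lt hur, add_zero] at this
  · obtain ⟨S, hS, hm, hS'⟩ := exists_truncSum_split hr a (t := t) hu
    rw [truncSum_eq_add_sum_Ico _ _ _ _ hS, Finset.sum_eq_zero, add_zero]
    · rcases hS' with h0 | ⟨n, h0⟩
      · rwa [h0, abs_zero]
      · rw [h0]
        exact hc n
    · intro m hmS
      rw [Finset.mem_Ico] at hmS
      have h1 := hm m hmS.1
      have h2 : r * m ≤ r * t := Nat.mul_le_mul_left r (by lia)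
      zify at h1 h2 hur hpqr
      rw [invBinaryCoeff_of_lt (by push_cast; lia) (by push_cast; lia), blockDiff, if_neg, if_neg]
      · simp
      all_goals push_cast; lia

theorem abs_truncSum_le_add_one {p q r : ℕ} (hlt : p < q) (h : p + q ≤ p * q) (hr : 0 < r)
    {a : ℕ → ℤ} (ha : ∀ n, ∑ m ∈ Finset.range n, a m = 0 ∨ ∑ m ∈ Finset.range n, a m = 1)
    {B : ℤ} (hB : 0 ≤ B)
    (hc : ∀ n : ℕ, |truncSum a (invBinaryCoeff p q) r n (n / r + 1)| ≤ B) (i : ℤ) (T : ℕ) :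
    |truncSum a (invBinaryCoeff p q) r i T| ≤ B + 1 := by
  rcases T with _ | t
  · simpa [truncSum] using by lia
  obtain ⟨u, hu, hi⟩ := exists_truncSum_residue p q (by lia) a r i t (t + 1)
  rw [hi]
  have hmul : ∀ {m n : ℕ}, m ≤ n → (r * m : ℤ) ≤ r * n := fun hmn => by
    exact_mod_cast Nat.mul_le_mul_left r hmn
  have hr' : (0 : ℤ) < r := by exact_mod_cast hr
  have h' : (p + q : ℤ) ≤ p * q := by exact_mod_cast h
  rcases le_or_gt u q with huq | huq
  · have h1 := hc (r * t + u)
    rw [Nat.mul_add_div hr, truncSum_eq_add_sum_Ico _ _ _ _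
      (show t + 1 ≤ t + u / r + 1 by lia)] at h1
    have h2 := abs_sum_Ico_ite_le_one ha (t + 1) (t + u / r + 1)
      (P := fun m => ((r * t + u : ℕ) - r * m : ℤ) < p)
      (fun m n hmn hm => lt_of_le_of_lt (by have := hmul hmn; lia) hm)
    rw [Finset.sum_congr rfl (g := fun m => a m *
      invBinaryCoeff p q ((r * t + u : ℕ) - r * m))] at h2
    · rw [abs_le] at h1 h2 ⊢
      constructor <;> linarith
    · intro m hm
      rw [Finset.mem_Ico] at hm
      have h3 := hmul hm.1
      have h4 : (r * m : ℤ) ≤ r * t + u := by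
        have := Nat.mul_div_le u r
        have := Nat.mul_le_mul_left r (Nat.lt_succ_iff.1 hm.2)
        zify at *
        lia
      push_cast at h3 ⊢
      rw [invBinaryCoeff_of_lt (by lia) (by lia), blockDiff]
      split_ifs <;> lia
  · obtain ⟨S, hS, hm, hS'⟩ := exists_truncSum_split hr a (t := t) hu
    rw [truncSum_eq_add_sum_Ico _ _ _ _ hS]
    have h1 : |truncSum a (invBinaryCoeff p q) r (r * t + u : ℕ) S| ≤ B := by
      rcases hS' with h0 | ⟨n, h0⟩
      · rwa [h0, abs_zero]
      · rw [h0]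
        exact hc n
    have h2 := abs_sum_Ico_ite_le_one ha S (t + 1)
      (P := fun m => ((r * t + u : ℕ) - r * m : ℤ) < p + q)
      (fun m n hmn hm => lt_of_le_of_lt (by have := hmul hmn; lia) hm)
    rw [← abs_neg, ← Finset.sum_neg_distrib, Finset.sum_congr rfl (g := fun m => a m *
      invBinaryCoeff p q ((r * t + u : ℕ) - r * m))] at h2
    · rw [abs_le] at h1 h2 ⊢
      constructor <;> linarith
    · intro m hmS
      rw [Finset.mem_Ico] at hmS
      have h3 := hmul (Nat.lt_succ_iff.1 hmS.2)
      have h4 := hm m hmS.1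
      zify at h4
      push_cast at h3 ⊢
      rw [invBinaryCoeff_of_lt (by lia) (by lia), blockDiff]
      split_ifs <;> lia

theorem truncSum_congr {p q r s : ℕ} (a : ℕ → ℤ) (h : Int.ModEq (p * q : ℤ) r s) (i : ℤ) (T : ℕ) :
    truncSum a (invBinaryCoeff p q) r i T = truncSum a (invBinaryCoeff p q) s i T := by
  refine Finset.sum_congr rfl fun m _ => ?_
  have h1 : (i - r * m : ℤ) % (p * q) = (i - s * m) % (p * q) := (h.mul_right m).sub_left i
  rw [invBinaryCoeff, h1, invBinaryCoeff]

theorem truncSum_reflect {p q r s : ℕ} (hlt : p < q) (hpq : p + q ≤ p * q) (a : ℕ → ℤ)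
    (h : Int.ModEq (p * q : ℤ) r (-s)) (i : ℤ) (T : ℕ) :
    truncSum a (invBinaryCoeff p q) r i T =
      -truncSum a (invBinaryCoeff p q) s (p + q - 1 - i) T := by
  rw [truncSum, truncSum, ← Finset.sum_neg_distrib]
  refine Finset.sum_congr rfl fun m _ => ?_
  have h1 : (i - r * m : ℤ) % (p * q) = (i - -s * m) % (p * q) := (h.mul_right m).sub_left i
  rw [invBinaryCoeff, h1, ← invBinaryCoeff, ← mul_neg, ← invBinaryCoeff_reflect hlt hpq]
  congr 2
  ring

theorem height_unitaryCyclotomic_congruent_of_lt {p q r s : ℕ}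
    (hp : IsPrimePow p) (hq : IsPrimePow q) (hr : IsPrimePow r) (hs : IsPrimePow s)
    (hp3 : 3 ≤ p) (hpq : Nat.Coprime p q) (hpr : Nat.Coprime p r) (hps : Nat.Coprime p s)
    (hqr : Nat.Coprime q r) (hqs : Nat.Coprime q s)
    (hcong : Int.ModEq (p * q : ℤ) r s ∨ Int.ModEq (p * q : ℤ) r (-s))
    (hlt : p < q) (hqr' : q < r) (hsq : s < q) :
    polyHeight (unitaryCyclotomic (p * q * s)) ≤ polyHeight (unitaryCyclotomic (p * q * r)) ∧
      polyHeight (unitaryCyclotomic (p * q * r)) ≤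
        polyHeight (unitaryCyclotomic (p * q * s)) + 1 := by
  have h : p + q ≤ p * q := by nlinarith
  have hle : p + q ≤ r := by
    have h3 : 3 * q ≤ p * q := Nat.mul_le_mul_right q hp3
    rcases hcong with hc | hc
    · have := Int.le_of_dvd (by lia) hc.symm.dvd
      zify at *
      lia
    · have := Int.le_of_dvd (by lia) hc.symm.dvd
      have : 0 ≤ (p - 3 : ℤ) * (q - 2) := mul_nonneg (by lia) (by lia)
      zify at *
      nlinarith
  set a := fun m => (unitaryCyclotomic (p * q)).coeff m with ha'
  have ha : ∀ n, ∑ m ∈ Finset.range n, a m = 0 ∨ ∑ m ∈ Finset.range n, a m = 1 :=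
    sum_coeff_unitaryCyclotomic_binary hp hq hpq
  have hcr : ∀ n, (unitaryCyclotomic (p * q * r)).coeff n =
      truncSum a (invBinaryCoeff p q) r n (n / r + 1) :=
    coeff_unitaryCyclotomic_ternary hp hq hr hpq hpr hqr h
  have hcs : ∀ n, (unitaryCyclotomic (p * q * s)).coeff n =
      truncSum a (invBinaryCoeff p q) s n (n / s + 1) :=
    coeff_unitaryCyclotomic_ternary hp hq hs hpq hps hqs h
  have hr1 := abs_truncSum_le_of_add_le (by lia) hr.pos hle a
    (B := polyHeight (unitaryCyclotomic (p * q * r))) (by positivity) fun n => by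
      rw [← hcr, Int.abs_eq_natAbs]
      exact_mod_cast natAbs_coeff_le_polyHeight _ _
  have hs1 := abs_truncSum_le_add_one hlt h hs.pos ha
    (B := polyHeight (unitaryCyclotomic (p * q * s))) (by positivity) fun n => by
      rw [← hcs, Int.abs_eq_natAbs]
      exact_mod_cast natAbs_coeff_le_polyHeight _ _
  have hrs : ∀ i T, ∃ j, |truncSum a (invBinaryCoeff p q) r j T| =
      |truncSum a (invBinaryCoeff p q) s i T| := fun i T => by
    rcases hcong with hc | hc
    · exact ⟨i, by rw [truncSum_congr a hc]⟩
    · refine ⟨p + q - 1 - i, ?_⟩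
      rw [truncSum_reflect hlt h a hc, abs_neg, sub_sub_cancel]
  have hsr : ∀ i T, ∃ j, |truncSum a (invBinaryCoeff p q) r i T| =
      |truncSum a (invBinaryCoeff p q) s j T| := fun i T => by
    rcases hcong with hc | hc
    · exact ⟨i, by rw [truncSum_congr a hc]⟩
    · exact ⟨_, by rw [truncSum_reflect hlt h a hc, abs_neg]⟩
  constructor
  · refine polyHeight_le fun n => ?_
    zify
    obtain ⟨j, hj⟩ := hrs n (n / s + 1)
    rw [hcs, ← hj]
    exact hr1 _ _
  · refine polyHeight_le fun n => ?_
    zify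
    obtain ⟨j, hj⟩ := hsr n (n / r + 1)
    rw [hcr, hj]
    exact hs1 _ _

/-- For four pairwise coprime prime powers `p, q, r, s ≥ 3` with `r ≡ ±s (mod pq)` and
`r > max(p, q) > s ≥ 3`: `H(Φ*_{pqs}) ≤ H(Φ*_{pqr}) ≤ H(Φ*_{pqs}) + 1`. -/
theorem height_unitaryCyclotomic_congruent (p q r s : ℕ)
    (hp : IsPrimePow p) (hq : IsPrimePow q) (hr : IsPrimePow r) (hs : IsPrimePow s)
    (hp3 : 3 ≤ p) (hq3 : 3 ≤ q) (hr3 : 3 ≤ r) (hs3 : 3 ≤ s)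
    (hpq : Nat.Coprime p q) (hpr : Nat.Coprime p r) (hps : Nat.Coprime p s)
    (hqr : Nat.Coprime q r) (hqs : Nat.Coprime q s) (hrs : Nat.Coprime r s)
    (hcong : Int.ModEq (p * q : ℤ) (r : ℤ) (s : ℤ) ∨
      Int.ModEq (p * q : ℤ) (r : ℤ) (-(s : ℤ)))
    (hrmax : max p q < r) (hsmax : s < max p q) :
    polyHeight (unitaryCyclotomic (p * q * s)) ≤ polyHeight (unitaryCyclotomic (p * q * r)) ∧
      polyHeight (unitaryCyclotomic (p * q * r)) ≤
        polyHeight (unitaryCyclotomic (p * q * s)) + 1 := by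
  rcases lt_trichotomy p q with h | rfl | h
  · rw [max_eq_right h.le] at hrmax hsmax
    exact height_unitaryCyclotomic_congruent_of_lt hp hq hr hs hp3 hpq hpr hps hqr hqs hcong h
      hrmax hsmax
  · exact absurd ((Nat.coprime_self p).1 hpq) (by lia)
  · rw [max_eq_left h.le] at hrmax hsmax
    rw [mul_comm p q]
    rw [mul_comm (p : ℤ) q] at hcong
    exact height_unitaryCyclotomic_congruent_of_lt hq hp hr hs hq3 hpq.symm hqr hqs hpr hps hcong h
      hrmax hsmax
end

section
/- Let p^a and q^b be two coprime prime powers (p, q distinct primes, a, b ≥ 1), and let r be a prime distinct from p and q. Then for every positive exponent c with r^c ≡ 1 (mod p^a q^b) or r^c ≡ −1 (mod p^a q^b), the polynomial Φ*_{p^a q^b r^c} is flat, i.e., all of its coefficients lie in {−1, 0, 1}. -/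
open Polynomial

open Classical in
/-- The indicator function on `ℤ` of the numerical semigroup generated by `P` and `Q`. -/
noncomputable def semigroupIndicator (P Q : ℕ) (k : ℤ) : ℤ :=
  if ∃ i j : ℕ, k = i * P + j * Q then 1 else 0

/-- The coefficient of `X ^ m` in `(1 - X ^ P) * (1 - X ^ Q) / (1 - X)`. -/
def windowCoeff (P Q : ℕ) (m : ℤ) : ℤ :=
  (if 0 ≤ m then 1 else 0) - (if (P : ℤ) ≤ m then 1 else 0) - (if (Q : ℤ) ≤ m then 1 else 0)
    + (if (P : ℤ) + Q ≤ m then 1 else 0)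

section SemigroupIndicator

variable {P Q : ℕ}

lemma semigroupIndicator_eq_zero_or_one (P Q : ℕ) (k : ℤ) :
    semigroupIndicator P Q k = 0 ∨ semigroupIndicator P Q k = 1 := by
  unfold semigroupIndicator
  split_ifs <;> simp

lemma semigroupIndicator_of_neg {k : ℤ} (hk : k < 0) : semigroupIndicator P Q k = 0 := by
  refine if_neg ?_
  rintro ⟨i, j, h⟩
  have : (0 : ℤ) ≤ i * P + j * Q := by positivity
  lia

lemma semigroupIndicator_comm (P Q : ℕ) (k : ℤ) :
    semigroupIndicator P Q k = semigroupIndicator Q P k := by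
  unfold semigroupIndicator
  congr 1
  rw [exists_comm]
  simp only [add_comm]

lemma semigroupIndicator_sub_left_le (P Q : ℕ) (k : ℤ) :
    semigroupIndicator P Q (k - P) ≤ semigroupIndicator P Q k := by
  unfold semigroupIndicator
  split_ifs with h h' <;> try simp
  obtain ⟨i, j, h⟩ := h
  exact h' ⟨i + 1, j, by push_cast; linarith⟩

lemma semigroupIndicator_sub_right_le (P Q : ℕ) (k : ℤ) :
    semigroupIndicator P Q (k - Q) ≤ semigroupIndicator P Q k := by
  simpa only [semigroupIndicator_comm P Q] using semigroupIndicator_sub_left_le Q P k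

open Classical in
lemma semigroupIndicator_sub_eq (hPQ : P.Coprime Q) (hP : 1 < P) (hQ : 1 < Q) (k : ℤ) :
    semigroupIndicator P Q k - semigroupIndicator P Q (k - P) =
      if ∃ j : ℕ, j < P ∧ k = j * Q then 1 else 0 := by
  have hle := semigroupIndicator_sub_left_le P Q k
  have h1 : (∃ j : ℕ, j < P ∧ k = j * Q) →
      semigroupIndicator P Q k = 1 ∧ semigroupIndicator P Q (k - P) = 0 := by
    rintro ⟨j, hj, rfl⟩
    refine ⟨if_pos ⟨0, j, by simp⟩, if_neg ?_⟩
    rintro ⟨i, l, h⟩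
    have h2 : ((j : ℤ) - l) * Q = P * (i + 1) := by linarith
    have h3 : (P : ℤ) ∣ (j : ℤ) - l :=
      (Nat.isCoprime_iff_coprime.mpr hPQ).dvd_of_dvd_mul_right ⟨_, h2⟩
    have h4 : 0 < ((j : ℤ) - l) * Q := by rw [h2]; positivity
    have h5 : 0 < (j : ℤ) - l := pos_of_mul_pos_left h4 (by positivity)
    have := Int.le_of_dvd h5 h3
    lia
  have h2 : semigroupIndicator P Q k = 1 → semigroupIndicator P Q (k - P) = 0 →
      ∃ j : ℕ, j < P ∧ k = j * Q := by
    intro hk hkP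
    have hk' : ∃ i j : ℕ, k = i * P + j * Q := by
      by_contra h
      simp [semigroupIndicator, h] at hk
    have hkP' : ¬ ∃ i j : ℕ, k - P = i * P + j * Q := by
      intro h
      simp [semigroupIndicator, h] at hkP
    obtain ⟨i, j, h⟩ := hk'
    rcases i with _ | i
    · refine ⟨j, ?_, by simpa using h⟩
      by_contra! hj
      obtain ⟨l, rfl⟩ := Nat.exists_eq_add_of_le hj
      obtain ⟨u, rfl⟩ := Nat.exists_eq_add_of_le' hQ.le
      exact hkP' ⟨u, l, by rw [h]; push_cast; ring⟩
    · exact absurd ⟨i, j, by rw [h]; push_cast; ring⟩ hkP'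
  rcases semigroupIndicator_eq_zero_or_one P Q k with h | h <;>
  rcases semigroupIndicator_eq_zero_or_one P Q (k - P) with h' | h' <;>
  split_ifs with hj <;> grind

lemma semigroupIndicator_recurrence (hPQ : P.Coprime Q) (hP : 1 < P) (hQ : 1 < Q) (k : ℤ) :
    semigroupIndicator P Q k - semigroupIndicator P Q (k - P) - semigroupIndicator P Q (k - Q)
      + semigroupIndicator P Q (k - P - Q) =
      (if k = 0 then 1 else 0) - (if k = P * Q then 1 else 0) := by
  classical
  have h1 := semigroupIndicator_sub_eq hPQ hP hQ k
  have h2 := semigroupIndicator_sub_eq hPQ hP hQ (k - Q)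
  rw [sub_right_comm k (Q : ℤ) P] at h2
  have key : ((if ∃ j : ℕ, j < P ∧ k = j * Q then 1 else 0) : ℤ)
      - (if ∃ j : ℕ, j < P ∧ k - Q = j * Q then 1 else 0) =
      (if k = 0 then 1 else 0) - (if k = P * Q then 1 else 0) := by
    by_cases hk : ∃ j : ℕ, k = j * Q
    · obtain ⟨j, rfl⟩ := hk
      have hQ0 : Q ≠ 0 := by positivity
      have e1 : (∃ l : ℕ, l < P ∧ (j : ℤ) * Q = l * Q) ↔ j < P := by
        simp [hQ0]
      have e2 : (∃ l : ℕ, l < P ∧ (j : ℤ) * Q - Q = l * Q) ↔ 0 < j ∧ j ≤ P := by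
        have : ∀ l : ℕ, (j : ℤ) * Q - Q = l * Q ↔ (j : ℤ) - 1 = l := fun l => by
          rw [← mul_left_inj' (c := (Q : ℤ)) (a := (j : ℤ) - 1) (Nat.cast_ne_zero.mpr hQ0),
            sub_mul, one_mul]
        simp only [this]
        constructor
        · rintro ⟨l, hl, h⟩
          lia
        · rintro ⟨h, h'⟩
          exact ⟨j - 1, by lia, by lia⟩
      have e3 : (j : ℤ) * Q = 0 ↔ j = 0 := by simp [hQ0]
      have e4 : (j : ℤ) * Q = P * Q ↔ j = P := by simp [hQ0]
      simp only [e1, e2, e3, e4]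
      split_ifs <;> lia
    · push Not at hk
      rw [if_neg, if_neg, if_neg, if_neg]
      · exact hk P
      · simpa using hk 0
      · rintro ⟨j, -, h⟩
        exact hk (j + 1) (by push_cast; linarith)
      · rintro ⟨j, -, h⟩
        exact hk j h
  linarith

lemma semigroupIndicator_eq_one_of_le (hPQ : P.Coprime Q) (hP : 1 < P) (hQ : 1 < Q) {k : ℤ}
    (hk : (P : ℤ) * Q - P - Q + 1 ≤ k) : semigroupIndicator P Q k = 1 := by
  have h0 : (0 : ℤ) ≤ ((P : ℤ) - 1) * (Q - 1) := mul_nonneg (by lia) (by lia)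
  lift k to ℕ using by linarith
  obtain ⟨i, j, h⟩ := Nat.exists_add_mul_eq_of_gcd_dvd_of_mul_pred_le P Q k
    (by simp [hPQ.gcd_eq_one])
    (by
      obtain ⟨P, rfl⟩ := Nat.exists_eq_add_of_le' hP.le
      obtain ⟨Q, rfl⟩ := Nat.exists_eq_add_of_le' hQ.le
      push_cast at hk
      zify
      simp
      linarith)
  exact if_pos ⟨i, j, by rw [← h]; push_cast; rfl⟩

end SemigroupIndicator

section Flatness

variable {P Q : ℕ}

lemma sum_semigroupIndicator_sub_mul_ite (P Q t : ℕ) (z : ℤ) :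
    ∑ i ∈ Finset.range (t + 1), (semigroupIndicator P Q i - semigroupIndicator P Q (i - 1)) *
      (if (i : ℤ) ≤ z then 1 else 0) = semigroupIndicator P Q (min t z) := by
  induction t with
  | zero =>
    rw [Finset.sum_range_one, semigroupIndicator_of_neg (k := ((0 : ℕ) : ℤ) - 1) (by simp)]
    split_ifs with h
    · simp at h; simp [h]
    · rw [Nat.cast_zero] at h ⊢
      rw [min_eq_right (by lia), semigroupIndicator_of_neg (k := z) (by lia), mul_zero]
  | succ t ih =>
    rw [Finset.sum_range_succ, ih]
    split_ifs with h
    · rw [min_eq_left (by lia), min_eq_left (by lia)]; push_cast; simp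
    · rw [min_eq_right (by lia), min_eq_right (by lia)]; simp

lemma sum_semigroupIndicator_sub_mul_windowCoeff (P Q t : ℕ) (s : ℤ) :
    ∑ i ∈ Finset.range (t + 1), (semigroupIndicator P Q i - semigroupIndicator P Q (i - 1)) *
      windowCoeff P Q (s - i) =
    semigroupIndicator P Q (min t s) - semigroupIndicator P Q (min t (s - P))
      - semigroupIndicator P Q (min t (s - Q)) + semigroupIndicator P Q (min t (s - P - Q)) := by
  have h : ∀ e : ℤ, ∑ i ∈ Finset.range (t + 1),
      (semigroupIndicator P Q i - semigroupIndicator P Q (i - 1)) *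
        (if e ≤ s - i then 1 else 0) = semigroupIndicator P Q (min t (s - e)) := fun e => by
    simp only [← sum_semigroupIndicator_sub_mul_ite, le_sub_comm]
  simp only [windowCoeff, mul_add, mul_sub _ (ite _ _ _),
    Finset.sum_add_distrib, Finset.sum_sub_distrib, h, sub_zero, sub_sub]

lemma abs_semigroupIndicator_min_le_one (hPQ : P.Coprime Q) (hP : 1 < P) (hQ : 1 < Q)
    (t : ℕ) {s : ℤ} (hs : s < P * Q) :
    |semigroupIndicator P Q (min t s) - semigroupIndicator P Q (min t (s - P))
      - semigroupIndicator P Q (min t (s - Q))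
      + semigroupIndicator P Q (min t (s - P - Q))| ≤ 1 := by
  have hrec := semigroupIndicator_recurrence hPQ hP hQ s
  rw [if_neg hs.ne] at hrec
  have m1 := semigroupIndicator_sub_left_le P Q (s - Q)
  have m2 := semigroupIndicator_sub_right_le P Q (s - P)
  rw [sub_right_comm] at m1
  have b1 := semigroupIndicator_eq_zero_or_one P Q s
  have b2 := semigroupIndicator_eq_zero_or_one P Q (s - P)
  have b3 := semigroupIndicator_eq_zero_or_one P Q (s - Q)
  have b4 := semigroupIndicator_eq_zero_or_one P Q (s - P - Q)
  have b5 := semigroupIndicator_eq_zero_or_one P Q t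
  have b6 := semigroupIndicator_eq_zero_or_one P Q (min t (s - P - Q))
  rw [abs_le]
  rcases le_or_gt s t with h | h
  · rw [min_eq_right h, min_eq_right (by lia), min_eq_right (by lia), min_eq_right (by lia), hrec]
    split_ifs <;> simp
  rw [if_neg (by lia)] at hrec
  rw [min_eq_left h.le]
  rcases le_or_gt (s - P) t with hsP | hsP <;> rcases le_or_gt (s - Q) t with hsQ | hsQ
  · rw [min_eq_right hsP, min_eq_right hsQ, min_eq_right (by lia)]
    lia
  · rw [min_eq_right hsP, min_eq_left hsQ.le, min_eq_right (by lia)]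
    lia
  · rw [min_eq_left hsP.le, min_eq_right hsQ, min_eq_right (by lia)]
    lia
  · rw [min_eq_left hsP.le, min_eq_left hsQ.le]
    lia

lemma windowCoeff_of_neg {m : ℤ} (hm : m < 0) : windowCoeff P Q m = 0 := by
  unfold windowCoeff
  split_ifs <;> lia

lemma windowCoeff_of_le {m : ℤ} (hm : (P : ℤ) + Q ≤ m) : windowCoeff P Q m = 0 := by
  unfold windowCoeff
  split_ifs <;> lia

lemma windowCoeff_neg (P Q : ℕ) (m : ℤ) :
    windowCoeff P Q (P + Q - 1 - m) = -windowCoeff P Q m := by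
  have h1 : (0 ≤ (P : ℤ) + Q - 1 - m) ↔ ¬ (P : ℤ) + Q ≤ m := by lia
  have h2 : ((P : ℤ) ≤ (P : ℤ) + Q - 1 - m) ↔ ¬ (Q : ℤ) ≤ m := by lia
  have h3 : ((Q : ℤ) ≤ (P : ℤ) + Q - 1 - m) ↔ ¬ (P : ℤ) ≤ m := by lia
  have h4 : ((P : ℤ) + Q ≤ (P : ℤ) + Q - 1 - m) ↔ ¬ 0 ≤ m := by lia
  simp only [windowCoeff, h1, h2, h3, h4, ite_not]
  split_ifs <;> rfl

lemma windowCoeff_emod_eq_add (hP : 1 < P) (hQ : 1 < Q) {z : ℤ} (hz : -(P * Q) ≤ z)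
    (hz' : z < P * Q) :
    windowCoeff P Q (z % (P * Q)) = windowCoeff P Q z + windowCoeff P Q (z + P * Q) := by
  have hle : (P : ℤ) + Q ≤ P * Q := by nlinarith
  rcases lt_or_ge z 0 with h | h
  · rw [windowCoeff_of_neg h, ← Int.add_emod_right, Int.emod_eq_of_lt (by lia) (by lia), zero_add]
  · rw [windowCoeff_of_le (m := z + P * Q) (by lia), Int.emod_eq_of_lt h hz', add_zero]

lemma windowCoeff_emod_neg (hP : 1 < P) (hQ : 1 < Q) (z : ℤ) :
    windowCoeff P Q ((P + Q - 1 - z) % (P * Q)) = -windowCoeff P Q (z % (P * Q)) := by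
  have hle : (P : ℤ) + Q ≤ P * Q := by nlinarith
  rw [Int.sub_emod, Int.emod_eq_of_lt (a := (P : ℤ) + Q - 1) (by lia) (by lia)]
  have h0 := Int.emod_nonneg z (show (P * Q : ℤ) ≠ 0 by positivity)
  have h1 := Int.emod_lt_of_pos z (show (0 : ℤ) < P * Q by positivity)
  rw [windowCoeff_emod_eq_add hP hQ (by lia) (by lia),
    windowCoeff_of_le (m := _ + (P : ℤ) * Q) (by lia), add_zero, windowCoeff_neg]

/-- Flatness of the truncations of
`(1 - X ^ (P * Q)) * (1 - X) / ((1 - X ^ P) * (1 - X ^ Q))` after multiplication by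
`(1 - X ^ P) * (1 - X ^ Q) / (1 - X)` and reduction modulo `X ^ (P * Q) - 1`. -/
lemma abs_sum_mul_windowCoeff_emod_le_one (hPQ : P.Coprime Q) (hP : 1 < P) (hQ : 1 < Q)
    (t : ℕ) (s : ℤ) :
    |∑ i ∈ Finset.range (t + 1), (semigroupIndicator P Q i - semigroupIndicator P Q (i - 1)) *
      windowCoeff P Q ((s - i) % (P * Q))| ≤ 1 := by
  have hle : (P : ℤ) + Q ≤ P * Q := by nlinarith
  wlog hs : 0 ≤ s ∧ s < P * Q generalizing s
  · have := this (s % (P * Q))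
      ⟨Int.emod_nonneg _ (by positivity), Int.emod_lt_of_pos _ (by positivity)⟩
    simpa only [Int.emod_sub_emod] using this
  wlog ht : (t : ℤ) ≤ P * Q - P - Q + 1 generalizing t
  · obtain ⟨u, hu⟩ : ∃ u : ℕ, (u : ℤ) = P * Q - P - Q + 1 := ⟨_, Int.toNat_of_nonneg (by lia)⟩
    have := this u hu.le
    rwa [Finset.sum_subset (Finset.range_subset_range.mpr (show u + 1 ≤ t + 1 by lia))] at this
    intro i _ hi
    rw [Finset.mem_range] at hi
    rw [semigroupIndicator_eq_one_of_le hPQ hP hQ (by lia),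
      semigroupIndicator_eq_one_of_le hPQ hP hQ (by lia), sub_self, zero_mul]
  rw [Finset.sum_congr rfl (g := fun i : ℕ =>
    (semigroupIndicator P Q i - semigroupIndicator P Q (i - 1)) * windowCoeff P Q (s - i) +
    (semigroupIndicator P Q i - semigroupIndicator P Q (i - 1)) *
      windowCoeff P Q (s + P * Q - i))]
  swap
  · intro i hi
    rw [Finset.mem_range] at hi
    rw [windowCoeff_emod_eq_add hP hQ (by lia) (by lia), mul_add, sub_add_eq_add_sub]
  rw [Finset.sum_add_distrib, sum_semigroupIndicator_sub_mul_windowCoeff,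
    sum_semigroupIndicator_sub_mul_windowCoeff, min_eq_left (b := s + P * Q) (by lia),
    min_eq_left (b := s + P * Q - P) (by lia), min_eq_left (b := s + P * Q - Q) (by lia)]
  have hflat := abs_semigroupIndicator_min_le_one hPQ hP hQ t hs.2
  rcases le_or_gt (t : ℤ) (s + P * Q - P - Q) with h | h
  · rw [min_eq_left h]
    simpa using hflat
  · obtain rfl : s = 0 := by lia
    have ht1 : semigroupIndicator P Q t = 1 :=
      semigroupIndicator_eq_one_of_le hPQ hP hQ (by lia)
    have h0 : semigroupIndicator P Q 0 = 1 := if_pos ⟨0, 0, by simp⟩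
    rw [min_eq_right (by lia), min_eq_right (by lia), min_eq_right (by lia), min_eq_right (by lia),
      semigroupIndicator_of_neg (k := 0 - P) (by lia),
      semigroupIndicator_of_neg (k := 0 - Q) (by lia),
      semigroupIndicator_of_neg (k := 0 - P - Q) (by lia), h0, ht1, abs_le]
    rcases semigroupIndicator_eq_zero_or_one P Q (min t (0 + P * Q - P - Q)) with h | h <;>
      rw [h] <;> simp

end Flatness

section Coefficients

variable {P Q : ℕ}

lemma mk_semigroupIndicator_mul (hPQ : P.Coprime Q) (hP : 1 < P) (hQ : 1 < Q) :
    (PowerSeries.mk fun n => semigroupIndicator P Q n) *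
      ((1 - PowerSeries.X ^ P) * (1 - PowerSeries.X ^ Q)) = 1 - PowerSeries.X ^ (P * Q) := by
  have hsub : ∀ n e : ℕ, (if e ≤ n then semigroupIndicator P Q ((n - e : ℕ) : ℤ) else 0) =
      semigroupIndicator P Q (n - e) := fun n e => by
    split_ifs with h
    · rw [Nat.cast_sub h]
    · rw [semigroupIndicator_of_neg (by lia)]
  ext n
  have hrec := semigroupIndicator_recurrence hPQ hP hQ n
  have hexp : (1 - PowerSeries.X ^ P : PowerSeries ℤ) * (1 - PowerSeries.X ^ Q) =
      1 - PowerSeries.X ^ P - PowerSeries.X ^ Q + PowerSeries.X ^ (P + Q) := by ring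
  simp only [hexp, mul_add, mul_sub, mul_one, map_add, map_sub, PowerSeries.coeff_mul_X_pow',
    PowerSeries.coeff_mk, hsub, PowerSeries.coeff_one, PowerSeries.coeff_X_pow]
  push_cast
  rw [← sub_sub, hrec]
  norm_cast

lemma coeff_eq_semigroupIndicator_sub (hPQ : P.Coprime Q) (hP : 1 < P) (hQ : 1 < Q) {A : ℤ[X]}
    (hA : A * ((X ^ P - 1) * (X ^ Q - 1)) = (X ^ (P * Q) - 1) * (X - 1)) (i : ℕ) :
    A.coeff i = semigroupIndicator P Q i - semigroupIndicator P Q (i - 1) := by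
  have hA' := congrArg (fun p : ℤ[X] => (p : PowerSeries ℤ)) hA
  simp only [coe_mul, coe_sub, coe_pow, coe_X, coe_one] at hA'
  have hne : ((1 - PowerSeries.X ^ P) * (1 - PowerSeries.X ^ Q) : PowerSeries ℤ) ≠ 0 := by
    intro h
    have := congrArg PowerSeries.constantCoeff h
    simp [show P ≠ 0 by lia, show Q ≠ 0 by lia] at this
  have key : (A : PowerSeries ℤ) =
      (PowerSeries.mk fun n => semigroupIndicator P Q n) * (1 - PowerSeries.X) := by
    apply mul_right_cancel₀ hne
    linear_combination hA' - (1 - PowerSeries.X) * mk_semigroupIndicator_mul hPQ hP hQ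
  rw [← coeff_coe, key, mul_sub, mul_one, map_sub]
  rcases i with _ | i
  · simp [semigroupIndicator_of_neg]
  · simp [PowerSeries.coeff_succ_mul_X]

lemma mk_windowCoeff_emod_mul (hP : 1 < P) (hQ : 1 < Q) :
    (PowerSeries.mk fun n => windowCoeff P Q (n % (P * Q))) *
      ((1 - PowerSeries.X ^ (P * Q)) * (1 - PowerSeries.X)) =
      (1 - PowerSeries.X ^ P) * (1 - PowerSeries.X ^ Q) := by
  have hle : P + Q ≤ P * Q := by nlinarith
  have h1 : (PowerSeries.mk fun n => windowCoeff P Q (n % (P * Q))) *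
      (1 - PowerSeries.X ^ (P * Q)) = PowerSeries.mk fun n => windowCoeff P Q n := by
    ext n
    rw [mul_sub, mul_one, map_sub, PowerSeries.coeff_mul_X_pow']
    simp only [PowerSeries.coeff_mk]
    split_ifs with h
    · rw [windowCoeff_of_le (m := (n : ℤ)) (by lia)]
      push_cast [Nat.cast_sub h]
      rw [Int.sub_emod_right, sub_self]
    · rw [Int.emod_eq_of_lt (by lia) (by lia), sub_zero]
  have h2 : (PowerSeries.mk fun n => windowCoeff P Q n) =
      (1 - PowerSeries.X ^ P) * (1 - PowerSeries.X ^ Q) * PowerSeries.mk 1 := by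
    ext n
    have hexp : (1 - PowerSeries.X ^ P : PowerSeries ℤ) * (1 - PowerSeries.X ^ Q) =
        1 - PowerSeries.X ^ P - PowerSeries.X ^ Q + PowerSeries.X ^ (P + Q) := by ring
    simp only [hexp, add_mul, sub_mul, one_mul, map_add, map_sub, PowerSeries.coeff_X_pow_mul',
      PowerSeries.coeff_mk, Pi.one_apply, windowCoeff]
    norm_cast
  rw [← mul_assoc, h1, h2, mul_assoc, PowerSeries.mk_one_mul_one_sub_eq_one, mul_one]

lemma coeff_eq_sum_mul_windowCoeff (hPQ : P.Coprime Q) (hP : 1 < P) (hQ : 1 < Q) {R : ℕ}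
    (hR : 0 < R) {A F : ℤ[X]}
    (hA : A * ((X ^ P - 1) * (X ^ Q - 1)) = (X ^ (P * Q) - 1) * (X - 1))
    (hF : F * ((X - 1) * (X ^ (P * Q) - 1) * (X ^ (P * R) - 1) * (X ^ (Q * R) - 1)) =
      (X ^ (P * Q * R) - 1) * (X ^ P - 1) * (X ^ Q - 1) * (X ^ R - 1)) (n : ℕ) :
    F.coeff n = ∑ i ∈ Finset.range (n / R + 1),
      (semigroupIndicator P Q i - semigroupIndicator P Q (i - 1)) *
        windowCoeff P Q ((n - i * R) % (P * Q)) := by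
  have hne : ∀ k : ℕ, 0 < k → (X ^ k - 1 : ℤ[X]) ≠ 0 := fun k hk =>
    (monic_X_pow_sub_C 1 hk.ne').ne_zero
  have hAR : expand ℤ R A * ((X ^ (P * R) - 1) * (X ^ (Q * R) - 1)) =
      (X ^ (P * Q * R) - 1) * (X ^ R - 1) := by
    have := congrArg (expand ℤ R) hA
    simp only [map_mul, map_sub, map_pow, expand_X, map_one, ← pow_mul] at this
    simpa only [mul_comm R] using this
  have hF' : F * ((X - 1) * (X ^ (P * Q) - 1)) =
      expand ℤ R A * ((X ^ P - 1) * (X ^ Q - 1)) := by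
    apply mul_right_cancel₀
      (mul_ne_zero (hne (P * R) (by positivity)) (hne (Q * R) (by positivity)))
    linear_combination hF - (X ^ P - 1) * (X ^ Q - 1) * hAR
  have hFs := congrArg (fun p : ℤ[X] => (p : PowerSeries ℤ)) hF'
  simp only [coe_mul, coe_sub, coe_pow, coe_X, coe_one] at hFs
  have hne' : ((1 - PowerSeries.X ^ (P * Q)) * (1 - PowerSeries.X) : PowerSeries ℤ) ≠ 0 := by
    intro h
    have := congrArg PowerSeries.constantCoeff h
    simp [show P ≠ 0 by lia, show Q ≠ 0 by lia] at this
  have key : (F : PowerSeries ℤ) =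
      (expand ℤ R A : PowerSeries ℤ) *
        PowerSeries.mk fun n => windowCoeff P Q (n % (P * Q)) := by
    apply mul_right_cancel₀ hne'
    linear_combination hFs - (expand ℤ R A : PowerSeries ℤ) * mk_windowCoeff_emod_mul hP hQ
  set M := A.natDegree + 1 + (n / R + 1)
  have hAM : (expand ℤ R A : PowerSeries ℤ) =
      ∑ i ∈ Finset.range M, PowerSeries.C (A.coeff i) * PowerSeries.X ^ (i * R) := by
    conv_lhs => rw [A.as_sum_range_C_mul_X_pow' (n := M) (by lia)]
    rw [map_sum, ← coeToPowerSeries.ringHom_apply, map_sum]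
    refine Finset.sum_congr rfl fun i _ => ?_
    simp [← pow_mul, mul_comm R, -eq_intCast]
  rw [← coeff_coe, key, hAM, Finset.sum_mul, map_sum]
  have hterm : ∀ i : ℕ, PowerSeries.coeff n (PowerSeries.C (A.coeff i) *
      PowerSeries.X ^ (i * R) * PowerSeries.mk fun n => windowCoeff P Q (n % (P * Q))) =
      if i ≤ n / R then (semigroupIndicator P Q i - semigroupIndicator P Q (i - 1)) *
        windowCoeff P Q ((n - i * R) % (P * Q)) else 0 := fun i => by
    rw [mul_assoc, PowerSeries.coeff_C_mul, PowerSeries.coeff_X_pow_mul',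
      coeff_eq_semigroupIndicator_sub hPQ hP hQ hA, PowerSeries.coeff_mk]
    simp only [Nat.le_div_iff_mul_le hR, mul_ite, mul_zero]
    split_ifs with h
    · push_cast [Nat.cast_sub h]
      rfl
    · rfl
  simp only [hterm]
  rw [← Finset.sum_subset (Finset.range_subset_range.mpr (show n / R + 1 ≤ M by lia))]
  · refine Finset.sum_congr rfl fun i hi => if_pos ?_
    rw [Finset.mem_range] at hi
    lia
  · intro i _ hi
    rw [Finset.mem_range] at hi
    exact if_neg (by lia)

/-- Flatness of the inclusion-exclusion polynomial of `P`, `Q`, `R` for `R ≡ ±1 [MOD P * Q]`. -/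
lemma abs_coeff_le_one_of_congruent (hPQ : P.Coprime Q) (hP : 1 < P) (hQ : 1 < Q) {R : ℕ}
    (hR : 0 < R) {A F : ℤ[X]}
    (hA : A * ((X ^ P - 1) * (X ^ Q - 1)) = (X ^ (P * Q) - 1) * (X - 1))
    (hF : F * ((X - 1) * (X ^ (P * Q) - 1) * (X ^ (P * R) - 1) * (X ^ (Q * R) - 1)) =
      (X ^ (P * Q * R) - 1) * (X ^ P - 1) * (X ^ Q - 1) * (X ^ R - 1))
    (hcong : (R : ℤ) ≡ 1 [ZMOD P * Q] ∨ (R : ℤ) ≡ -1 [ZMOD P * Q]) (n : ℕ) :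
    |F.coeff n| ≤ 1 := by
  rw [coeff_eq_sum_mul_windowCoeff hPQ hP hQ hR hA hF]
  rcases hcong with h | h
  · have hmod : ∀ i : ℕ, ((n : ℤ) - i * R) % (P * Q) = (n - i) % (P * Q) := fun i => by
      rw [← Int.ModEq]
      simpa using (Int.ModEq.refl (n : ℤ)).sub (h.mul_left i)
    simp only [hmod]
    exact abs_sum_mul_windowCoeff_emod_le_one hPQ hP hQ _ _
  · have hmod : ∀ i : ℕ, windowCoeff P Q (((n : ℤ) - i * R) % (P * Q)) =
        -windowCoeff P Q ((P + Q - 1 - n - i) % (P * Q)) := fun i => by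
      rw [← windowCoeff_emod_neg hP hQ]
      congr 1
      have : (n : ℤ) - i * R ≡ P + Q - 1 - (P + Q - 1 - n - i) [ZMOD P * Q] := by
        convert (Int.ModEq.refl (n : ℤ)).sub (h.mul_left i) using 1
        ring
      exact this
    simp only [hmod, mul_neg, Finset.sum_neg_distrib, abs_neg]
    exact abs_sum_mul_windowCoeff_emod_le_one hPQ hP hQ _ _

end Coefficients

section Divisors

lemma Nat.Coprime.prod_divisors_mul {M : Type*} [CommMonoid M] {m n : ℕ} (hmn : m.Coprime n)
    (f : ℕ → M) :
    ∏ d ∈ (m * n).divisors, f d = ∏ d ∈ m.divisors, ∏ e ∈ n.divisors, f (d * e) := by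
  rw [Nat.divisors_mul, Finset.mul_def, Finset.prod_image hmn.mul_injOn_divisors,
    Finset.prod_product]

variable {p q r : ℕ}

lemma prod_divisors_prime_pow_mul {M : Type*} [CommMonoid M] (hp : p.Prime) (hq : q.Prime)
    (hpq : p ≠ q) (a b : ℕ) (f : ℕ → M) :
    ∏ d ∈ (p ^ a * q ^ b).divisors, f d =
      ∏ i ∈ Finset.range (a + 1), ∏ j ∈ Finset.range (b + 1), f (p ^ i * q ^ j) := by
  rw [((Nat.coprime_primes hp hq).mpr hpq |>.pow a b).prod_divisors_mul,
    Nat.prod_divisors_prime_pow hp]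
  simp only [Nat.prod_divisors_prime_pow hq]

lemma prod_divisors_prime_pow_mul_mul {M : Type*} [CommMonoid M] (hp : p.Prime) (hq : q.Prime)
    (hr : r.Prime) (hpq : p ≠ q) (hrp : r ≠ p) (hrq : r ≠ q) (a b c : ℕ) (f : ℕ → M) :
    ∏ d ∈ (p ^ a * q ^ b * r ^ c).divisors, f d = ∏ i ∈ Finset.range (a + 1),
      ∏ j ∈ Finset.range (b + 1), ∏ k ∈ Finset.range (c + 1), f (p ^ i * q ^ j * r ^ k) := by
  have hcop : (p ^ a * q ^ b).Coprime (r ^ c) := Nat.Coprime.mul_left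
    (((Nat.coprime_primes hp hr).mpr hrp.symm).pow a c)
    (((Nat.coprime_primes hq hr).mpr hrq.symm).pow b c)
  rw [hcop.prod_divisors_mul, prod_divisors_prime_pow_mul hp hq hpq]
  simp only [Nat.prod_divisors_prime_pow hr]

lemma prod_cyclotomic_prime_pow_succ (hp : p.Prime) (a : ℕ) :
    (∏ i ∈ Finset.range a, cyclotomic (p ^ (i + 1)) ℤ) * (X - 1) = X ^ p ^ a - 1 := by
  rw [← prod_cyclotomic_eq_X_pow_sub_one (pow_pos hp.pos a), Nat.prod_divisors_prime_pow hp,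
    Finset.prod_range_succ', pow_zero, cyclotomic_one]

lemma prod_cyclotomic_two_prime_pow_succ (hp : p.Prime) (hq : q.Prime) (hpq : p ≠ q) (a b : ℕ) :
    (∏ i ∈ Finset.range a, ∏ j ∈ Finset.range b, cyclotomic (p ^ (i + 1) * q ^ (j + 1)) ℤ) *
      ((X ^ p ^ a - 1) * (X ^ q ^ b - 1)) = (X ^ (p ^ a * q ^ b) - 1) * (X - 1) := by
  have hpos : 0 < p ^ a * q ^ b := mul_pos (pow_pos hp.pos a) (pow_pos hq.pos b)
  rw [← prod_cyclotomic_eq_X_pow_sub_one hpos, prod_divisors_prime_pow_mul hp hq hpq,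
    ← prod_cyclotomic_prime_pow_succ hp, ← prod_cyclotomic_prime_pow_succ hq]
  simp only [Finset.prod_range_succ', pow_zero, one_mul, mul_one, cyclotomic_one,
    Finset.prod_mul_distrib]
  ring

lemma prod_cyclotomic_three_prime_pow_succ (hp : p.Prime) (hq : q.Prime) (hr : r.Prime)
    (hpq : p ≠ q) (hrp : r ≠ p) (hrq : r ≠ q) (a b c : ℕ) :
    (∏ i ∈ Finset.range a, ∏ j ∈ Finset.range b, ∏ k ∈ Finset.range c,
      cyclotomic (p ^ (i + 1) * q ^ (j + 1) * r ^ (k + 1)) ℤ) *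
      ((X - 1) * (X ^ (p ^ a * q ^ b) - 1) * (X ^ (p ^ a * r ^ c) - 1) *
        (X ^ (q ^ b * r ^ c) - 1)) =
      (X ^ (p ^ a * q ^ b * r ^ c) - 1) * (X ^ p ^ a - 1) * (X ^ q ^ b - 1) *
        (X ^ r ^ c - 1) := by
  have hp0 := pow_pos hp.pos a
  have hq0 := pow_pos hq.pos b
  have hr0 := pow_pos hr.pos c
  rw [← prod_cyclotomic_eq_X_pow_sub_one (by positivity : 0 < p ^ a * q ^ b * r ^ c),
    ← prod_cyclotomic_eq_X_pow_sub_one (by positivity : 0 < p ^ a * q ^ b),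
    ← prod_cyclotomic_eq_X_pow_sub_one (by positivity : 0 < p ^ a * r ^ c),
    ← prod_cyclotomic_eq_X_pow_sub_one (by positivity : 0 < q ^ b * r ^ c),
    prod_divisors_prime_pow_mul_mul hp hq hr hpq hrp hrq,
    prod_divisors_prime_pow_mul hp hq hpq, prod_divisors_prime_pow_mul hp hr hrp.symm,
    prod_divisors_prime_pow_mul hq hr hrq.symm,
    ← prod_cyclotomic_prime_pow_succ hp, ← prod_cyclotomic_prime_pow_succ hq,
    ← prod_cyclotomic_prime_pow_succ hr]
  simp only [Finset.prod_range_succ', pow_zero, one_mul, mul_one, cyclotomic_one,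
    Finset.prod_mul_distrib]
  ring

lemma unitaryCyclotomic_eq_prod (hp : p.Prime) (hq : q.Prime) (hr : r.Prime)
    (hpq : p ≠ q) (hrp : r ≠ p) (hrq : r ≠ q) {a b c : ℕ} (ha : 1 ≤ a) (hb : 1 ≤ b) (hc : 1 ≤ c) :
    unitaryCyclotomic (p ^ a * q ^ b * r ^ c) =
      ∏ i ∈ Finset.range a, ∏ j ∈ Finset.range b, ∏ k ∈ Finset.range c,
        cyclotomic (p ^ (i + 1) * q ^ (j + 1) * r ^ (k + 1)) ℤ := by
  have hmem : ∀ {s : ℕ}, s.Prime → ∀ i j k : ℕ, s ∈ (p ^ i * q ^ j * r ^ k).primeFactors ↔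
      (s = p ∧ i ≠ 0) ∨ (s = q ∧ j ≠ 0) ∨ (s = r ∧ k ≠ 0) := by
    intro s hs i j k
    have hpow : ∀ {t : ℕ}, t.Prime → ∀ l : ℕ, s ∣ t ^ l ↔ s = t ∧ l ≠ 0 := by
      intro t ht l
      rcases eq_or_ne l 0 with rfl | hl
      · simpa using hs.ne_one
      · exact ⟨fun h => ⟨Nat.prime_eq_prime_of_dvd_pow hs ht h, hl⟩,
          fun h => h.1 ▸ dvd_pow_self _ hl⟩
    rw [Nat.mem_primeFactors_of_ne_zero
      (by simp [hp.ne_zero, hq.ne_zero, hr.ne_zero]), hs.dvd_mul, hs.dvd_mul, hpow hp, hpow hq,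
      hpow hr, or_assoc]
    simp [hs]
  have hiff : ∀ i j k : ℕ, (p ^ i * q ^ j * r ^ k).primeFactors =
      (p ^ a * q ^ b * r ^ c).primeFactors ↔ i ≠ 0 ∧ j ≠ 0 ∧ k ≠ 0 := by
    intro i j k
    constructor
    · intro h
      have h1 := hmem hp i j k
      have h2 := hmem hq i j k
      have h3 := hmem hr i j k
      rw [h, hmem (by assumption)] at h1 h2 h3
      lia
    · intro h
      ext s
      by_cases hs : s.Prime
      · rw [hmem hs, hmem hs]
        lia
      · simp [hs]
  rw [unitaryCyclotomic, Finset.prod_filter,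
    prod_divisors_prime_pow_mul_mul hp hq hr hpq hrp hrq]
  simp only [hiff, Finset.prod_range_succ', Finset.prod_mul_distrib]
  simp

end Divisors

/-- For coprime prime powers `p^a, q^b` and a prime `r ∉ {p, q}`, if `c ≥ 1` satisfies
`r^c ≡ ±1 (mod p^a q^b)`, then `Φ*_{p^a q^b r^c}` is flat: all its coefficients
lie in `{−1, 0, 1}`. -/
theorem unitaryCyclotomic_flat_of_congruent (p q r a b c : ℕ)
    (hp : p.Prime) (hq : q.Prime) (hr : r.Prime)
    (hpq : p ≠ q) (hrp : r ≠ p) (hrq : r ≠ q)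
    (ha : 1 ≤ a) (hb : 1 ≤ b) (hc : 1 ≤ c)
    (hcong : Int.ModEq ((p ^ a * q ^ b : ℕ) : ℤ) ((r : ℤ) ^ c) 1 ∨
      Int.ModEq ((p ^ a * q ^ b : ℕ) : ℤ) ((r : ℤ) ^ c) (-1)) :
    ∀ j : ℕ, (unitaryCyclotomic (p ^ a * q ^ b * r ^ c)).coeff j ∈ ({-1, 0, 1} : Set ℤ) := by
  intro j
  have hflat := abs_coeff_le_one_of_congruent (((Nat.coprime_primes hp hq).mpr hpq).pow a b)
    (Nat.one_lt_pow (by lia) hp.one_lt) (Nat.one_lt_pow (by lia) hq.one_lt) (pow_pos hr.pos c)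
    (prod_cyclotomic_two_prime_pow_succ hp hq hpq a b)
    (prod_cyclotomic_three_prime_pow_succ hp hq hr hpq hrp hrq a b c)
    (by simpa using hcong) j
  rw [← unitaryCyclotomic_eq_prod hp hq hr hpq hrp hrq ha hb hc, abs_le] at hflat
  simp only [Set.mem_insert_iff, Set.mem_singleton_iff]
  lia
end

section
/- Let p < q < r be pairwise coprime prime powers. Then every coefficient c of Ψ*_{pqr} satisfies |c| ≤ ⌊(p−1)(q−1)/r⌋ + 1, and moreover ⌊(p−1)(q−1)/r⌋ + 1 ≤ p − 1; in particular H(Ψ*_{pqr}) ≤ p − 1, where H(f) denotes the maximum of the absolute values of the coefficients of f. -/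
open Polynomial

/-- The inverse unitary cyclotomic polynomial `Ψ*_n`, satisfying `Φ*_n · Ψ*_n = X^n − 1`. -/
noncomputable def unitaryCyclotomicInv (n : ℕ) : Polynomial ℤ :=
  (X ^ n - 1) /ₘ unitaryCyclotomic n

/-- The factorization `X ^ (r * p) - 1 = (X ^ r - 1) * (1 + X ^ r + ⋯ + X ^ (r * (p - 1)))`. -/
theorem Polynomial.X_pow_mul_sub_one_eq (p r : ℕ) :
    (X : ℤ[X]) ^ (p * r) - 1 = (X ^ r - 1) * ∑ i ∈ Finset.range p, X ^ (r * i) := by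
  rw [mul_comm p r, pow_mul, ← mul_geom_sum]
  simp only [pow_mul]

theorem Nat.divisors_inter_divisors {m n : ℕ} (hm : m ≠ 0) (hn : n ≠ 0) :
    m.divisors ∩ n.divisors = (m.gcd n).divisors := by
  ext d
  simp [Nat.dvd_gcd_iff, hm, hn]

/-- Over the divisors of `m` or `n`, the cyclotomic polynomials multiply to
`(X ^ m - 1) * (X ^ n - 1) / (X ^ gcd m n - 1)`. -/
theorem prod_cyclotomic_divisors_union {m n : ℕ} (hm : m ≠ 0) (hn : n ≠ 0) :
    (∏ d ∈ m.divisors ∪ n.divisors, cyclotomic d ℤ) * (X ^ m.gcd n - 1) =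
      (X ^ m - 1) * (X ^ n - 1) := by
  rw [← prod_cyclotomic_eq_X_pow_sub_one (Nat.gcd_pos_of_pos_left n (Nat.pos_of_ne_zero hm)),
    ← prod_cyclotomic_eq_X_pow_sub_one (Nat.pos_of_ne_zero hm),
    ← prod_cyclotomic_eq_X_pow_sub_one (Nat.pos_of_ne_zero hn),
    ← Nat.divisors_inter_divisors hm hn, Finset.prod_union_inter]

theorem IsPrimePow.exists_prime_dvd_iff_not_coprime {r : ℕ} (hr : IsPrimePow r) :
    ∃ l, l.Prime ∧ r.primeFactors = {l} ∧ ∀ d : ℕ, l ∣ d ↔ ¬ d.Coprime r := by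
  obtain ⟨l, e, hl, he, rfl⟩ := (isPrimePow_nat_iff r).1 hr
  refine ⟨l, hl, Nat.primeFactors_prime_pow he.ne' hl, fun d => ?_⟩
  rw [Nat.coprime_pow_right_iff he, Nat.coprime_comm, hl.coprime_iff_not_dvd, not_not]

theorem primeFactors_eq_iff_of_dvd {p q r d : ℕ}
    (hp : IsPrimePow p) (hq : IsPrimePow q) (hr : IsPrimePow r)
    (hpq : p.Coprime q) (hpr : p.Coprime r) (hqr : q.Coprime r) (hd : d ∣ p * q * r) :
    d.primeFactors = (p * q * r).primeFactors ↔
      ¬ (d ∣ p * q ∨ d ∣ p * r ∨ d ∣ q * r) := by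
  have h0 : p * q * r ≠ 0 := mul_ne_zero (mul_ne_zero hp.ne_zero hq.ne_zero) hr.ne_zero
  have hd0 : d ≠ 0 := ne_zero_of_dvd_ne_zero h0 hd
  obtain ⟨a, ha, hpa, hda⟩ := hp.exists_prime_dvd_iff_not_coprime
  obtain ⟨b, hb, hqb, hdb⟩ := hq.exists_prime_dvd_iff_not_coprime
  obtain ⟨c, hc, hrc, hdc⟩ := hr.exists_prime_dvd_iff_not_coprime
  have hr' : d ∣ p * q ↔ d.Coprime r :=
    ⟨fun h => (hpr.mul_left hqr).coprime_dvd_left h, fun h => h.dvd_of_dvd_mul_right hd⟩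
  have hq' : d ∣ p * r ↔ d.Coprime q :=
    ⟨fun h => (hpq.mul_left hqr.symm).coprime_dvd_left h,
      fun h => h.dvd_of_dvd_mul_right (by rwa [mul_right_comm] at hd)⟩
  have hp' : d ∣ q * r ↔ d.Coprime p :=
    ⟨fun h => (hpq.symm.mul_left hpr.symm).coprime_dvd_left h,
      fun h => h.dvd_of_dvd_mul_left (by rwa [mul_assoc] at hd)⟩
  rw [hr', hq', hp', not_or, not_or, ← hda, ← hdb, ← hdc]
  have hn : (p * q * r).primeFactors = {a} ∪ {b} ∪ {c} := by
    rw [Nat.primeFactors_mul (mul_ne_zero hp.ne_zero hq.ne_zero) hr.ne_zero,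
      Nat.primeFactors_mul hp.ne_zero hq.ne_zero, hpa, hqb, hrc]
  constructor
  · intro h
    rw [hn] at h
    refine ⟨?_, ?_, ?_⟩ <;> refine Nat.dvd_of_mem_primeFactors ?_ <;> rw [h] <;> simp
  · rintro ⟨h3, h2, h1⟩
    refine (Nat.primeFactors_mono hd h0).antisymm ?_
    rw [hn]
    intro x hx
    simp only [Finset.mem_union, Finset.mem_singleton, or_assoc] at hx
    rcases hx with rfl | rfl | rfl
    exacts [Nat.mem_primeFactors.2 ⟨ha, h1, hd0⟩, Nat.mem_primeFactors.2 ⟨hb, h2, hd0⟩,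
      Nat.mem_primeFactors.2 ⟨hc, h3, hd0⟩]

theorem unitaryCyclotomic_monic (n : ℕ) : (unitaryCyclotomic n).Monic :=
  monic_prod_of_monic _ _ fun d _ => cyclotomic.monic d ℤ

theorem unitaryCyclotomicInv_eq_prod {n : ℕ} (hn : n ≠ 0) :
    unitaryCyclotomicInv n =
      ∏ d ∈ n.divisors.filter (fun d => ¬ d.primeFactors = n.primeFactors), cyclotomic d ℤ := by
  rw [unitaryCyclotomicInv, ← prod_cyclotomic_eq_X_pow_sub_one (Nat.pos_of_ne_zero hn),
    ← Finset.prod_filter_mul_prod_filter_not _ (fun d => d.primeFactors = n.primeFactors)]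
  exact mul_divByMonic_cancel_left _ (unitaryCyclotomic_monic n)

theorem unitaryCyclotomicInv_mul {p q r : ℕ}
    (hp : IsPrimePow p) (hq : IsPrimePow q) (hr : IsPrimePow r)
    (hpq : p.Coprime q) (hpr : p.Coprime r) (hqr : q.Coprime r) :
    unitaryCyclotomicInv (p * q * r) * ((X ^ p - 1) * (X ^ q - 1) * (X ^ r - 1)) =
      (X ^ (p * q) - 1) * (X ^ (p * r) - 1) * (X ^ (q * r) - 1) * (X - 1) := by
  have p0 := hp.ne_zero
  have q0 := hq.ne_zero
  have r0 := hr.ne_zero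
  have hset : (p * q * r).divisors.filter
      (fun d => ¬ d.primeFactors = (p * q * r).primeFactors) =
      ((p * q).divisors ∪ (p * r).divisors) ∪ (q * r).divisors := by
    ext d
    simp only [Finset.mem_filter, Finset.mem_union, Nat.mem_divisors]
    constructor
    · rintro ⟨⟨hd, -⟩, h⟩
      rw [primeFactors_eq_iff_of_dvd hp hq hr hpq hpr hqr hd, not_not] at h
      simpa [p0, q0, r0, or_assoc] using h
    · intro h
      have hd : d ∣ p * q * r := by
        rcases h with (h | h) | h
        · exact h.1.mul_right r
        · rw [mul_right_comm]
          exact h.1.mul_right q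
        · rw [mul_assoc]
          exact h.1.mul_left p
      refine ⟨⟨hd, by simp [p0, q0, r0]⟩, ?_⟩
      rw [primeFactors_eq_iff_of_dvd hp hq hr hpq hpr hqr hd, not_not]
      simpa [p0, q0, r0, or_assoc] using h
  have hinter : ((p * q).divisors ∪ (p * r).divisors) ∩ (q * r).divisors =
      q.divisors ∪ r.divisors := by
    rw [Finset.union_inter_distrib_right,
      Nat.divisors_inter_divisors (mul_ne_zero p0 q0) (mul_ne_zero q0 r0),
      Nat.divisors_inter_divisors (mul_ne_zero p0 r0) (mul_ne_zero q0 r0),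
      mul_comm p q, Nat.gcd_mul_left, Nat.gcd_mul_right, hpr.gcd_eq_one, hpq.gcd_eq_one,
      mul_one, one_mul]
  have h1 := prod_cyclotomic_divisors_union (mul_ne_zero p0 q0) (mul_ne_zero p0 r0)
  rw [Nat.gcd_mul_left, hqr.gcd_eq_one, mul_one] at h1
  have h2 := prod_cyclotomic_divisors_union q0 r0
  rw [hqr.gcd_eq_one, pow_one] at h2
  have h3 := Finset.prod_union_inter (s₁ := (p * q).divisors ∪ (p * r).divisors)
    (s₂ := (q * r).divisors) (f := fun d => cyclotomic d ℤ)
  rw [hinter, prod_cyclotomic_eq_X_pow_sub_one (Nat.pos_of_ne_zero (mul_ne_zero q0 r0))] at h3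
  rw [unitaryCyclotomicInv_eq_prod (mul_ne_zero (mul_ne_zero p0 q0) r0), hset]
  linear_combination (X ^ (q * r) - 1) * (X - 1) * h1 + (X ^ p - 1) * (X - 1) * h3 -
    (∏ d ∈ ((p * q).divisors ∪ (p * r).divisors) ∪ (q * r).divisors, cyclotomic d ℤ) *
      (X ^ p - 1) * h2

theorem PowerSeries.mk_dvd_mul_one_sub_X_pow {q : ℕ} (hq : q ≠ 0) :
    (PowerSeries.mk fun k => if q ∣ k then (1 : ℤ) else 0) * (1 - PowerSeries.X ^ q) = 1 := by
  ext k
  rw [mul_sub, mul_one, map_sub, PowerSeries.coeff_mul_X_pow', PowerSeries.coeff_one]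
  simp only [PowerSeries.coeff_mk]
  rcases le_or_gt q k with h | h
  · rw [if_pos h, if_neg (by omega : k ≠ 0)]
    simp [Nat.dvd_sub_iff_left h dvd_rfl]
  · rw [if_neg (not_le.2 h), sub_zero]
    refine if_congr ⟨fun hd => Nat.eq_zero_of_dvd_of_lt hd h, fun h => h ▸ dvd_zero q⟩ rfl rfl

/-- For coprime `p` and `q`, every integer has at most one representation `p * i + q * j` with
`0 ≤ i < q` and `0 ≤ j`. -/
theorem coeff_sum_X_pow_mul_mk_dvd_mem {p q : ℕ} (hpq : p.Coprime q) (k : ℕ) :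
    let h := PowerSeries.coeff k
      ((∑ i ∈ Finset.range q, (PowerSeries.X : PowerSeries ℤ) ^ (p * i)) *
        PowerSeries.mk fun k => if q ∣ k then (1 : ℤ) else 0)
    0 ≤ h ∧ h ≤ 1 := by
  have hcoeff : PowerSeries.coeff k
      ((∑ i ∈ Finset.range q, (PowerSeries.X : PowerSeries ℤ) ^ (p * i)) *
        PowerSeries.mk fun k => if q ∣ k then (1 : ℤ) else 0) =
      (((Finset.range q).filter fun i => p * i ≤ k ∧ q ∣ k - p * i).card : ℤ) := by
    rw [Finset.sum_mul, map_sum, Finset.card_filter, Nat.cast_sum]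
    refine Finset.sum_congr rfl fun i _ => ?_
    rw [PowerSeries.coeff_X_pow_mul', PowerSeries.coeff_mk, ite_and]
    push_cast
    rfl
  simp only [hcoeff]
  refine ⟨by positivity, ?_⟩
  norm_cast
  refine Finset.card_le_one.2 fun i hi j hj => ?_
  simp only [Finset.mem_filter, Finset.mem_range] at hi hj
  have hi' := (Nat.modEq_iff_dvd' hi.2.1).2 hi.2.2
  have hj' := (Nat.modEq_iff_dvd' hj.2.1).2 hj.2.2
  have hij : i ≡ j [MOD q] :=
    Nat.ModEq.cancel_left_of_coprime hpq.symm.gcd_eq_one (hi'.trans hj'.symm)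
  exact hij.eq_of_lt_of_lt hi.1 hj.1

/-- For coprime `p` and `q`, the polynomial
`(X ^ (p * q) - 1) * (X - 1) / ((X ^ p - 1) * (X ^ q - 1))` exists, has degree at most
`(p - 1) * (q - 1)`, and is flat. -/
theorem exists_flat_polynomial {p q : ℕ} (hp : 1 < p) (hq : 1 < q) (hpq : p.Coprime q) :
    ∃ P : ℤ[X], P * ((X ^ p - 1) * (X ^ q - 1)) = (X ^ (p * q) - 1) * (X - 1) ∧
      P.natDegree ≤ (p - 1) * (q - 1) ∧ ∀ k, (P.coeff k).natAbs ≤ 1 := by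
  have p0 : p ≠ 0 := by omega
  have q0 : q ≠ 0 := by omega
  have hsub : p.divisors ∪ q.divisors ⊆ (p * q).divisors :=
    Finset.union_subset (Nat.divisors_subset_of_dvd (mul_ne_zero p0 q0) (dvd_mul_right p q))
      (Nat.divisors_subset_of_dvd (mul_ne_zero p0 q0) (dvd_mul_left q p))
  have h1 := prod_cyclotomic_divisors_union p0 q0
  rw [hpq.gcd_eq_one, pow_one] at h1
  have h2 := Finset.prod_sdiff (f := fun d => cyclotomic d ℤ) hsub
  rw [prod_cyclotomic_eq_X_pow_sub_one (Nat.pos_of_ne_zero (mul_ne_zero p0 q0))] at h2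
  set P := ∏ d ∈ (p * q).divisors \ (p.divisors ∪ q.divisors), cyclotomic d ℤ
  have hP : P * ((X ^ p - 1) * (X ^ q - 1)) = (X ^ (p * q) - 1) * (X - 1) := by
    linear_combination (X - 1) * h2 - P * h1
  have hmp : ((X : ℤ[X]) ^ p - 1).Monic := monic_X_pow_sub_C 1 p0
  have hmq : ((X : ℤ[X]) ^ q - 1).Monic := monic_X_pow_sub_C 1 q0
  have hmpq : ((X : ℤ[X]) ^ (p * q) - 1).Monic := monic_X_pow_sub_C 1 (mul_ne_zero p0 q0)
  have hPm : P.Monic := monic_prod_of_monic _ _ fun d _ => cyclotomic.monic d ℤ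
  refine ⟨P, hP, ?_, fun k => ?_⟩
  · have hdeg := congrArg natDegree hP
    have hX : ((X : ℤ[X]) - 1).Monic := monic_X_sub_C 1
    have hX1 : ((X : ℤ[X]) - 1).natDegree = 1 := natDegree_X_sub_C 1
    have hXn (n : ℕ) : ((X : ℤ[X]) ^ n - 1).natDegree = n := natDegree_X_pow_sub_C
    rw [hPm.natDegree_mul (hmp.mul hmq), hmp.natDegree_mul hmq, hmpq.natDegree_mul hX,
      hX1, hXn, hXn, hXn] at hdeg
    obtain ⟨a, rfl⟩ := Nat.exists_eq_add_of_lt hp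
    obtain ⟨b, rfl⟩ := Nat.exists_eq_add_of_lt hq
    simp only [Nat.add_sub_cancel_left, Nat.add_assoc] at *
    nlinarith
  · have hPq : P * (X ^ q - 1) = (X - 1) * ∑ i ∈ Finset.range q, X ^ (p * i) := by
      refine mul_right_cancel₀ hmp.ne_zero ?_
      have := Polynomial.X_pow_mul_sub_one_eq q p
      rw [mul_comm q p] at this
      linear_combination hP + (X - 1) * this
    have hPS := congrArg (fun f : ℤ[X] => (f : PowerSeries ℤ)) hPq
    simp only [coe_mul, coe_sub, coe_pow, coe_X, coe_one] at hPS
    rw [← Polynomial.coeToPowerSeries.ringHom_apply (φ := ∑ i ∈ Finset.range q, X ^ (p * i)),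
      map_sum] at hPS
    simp only [coeToPowerSeries.ringHom_apply, coe_pow, coe_X] at hPS
    have hgeom := PowerSeries.mk_dvd_mul_one_sub_X_pow q0
    have hmem := coeff_sum_X_pow_mul_mk_dvd_mem hpq
    set G := PowerSeries.mk fun k => if q ∣ k then (1 : ℤ) else 0
    set S := ∑ i ∈ Finset.range q, (PowerSeries.X : PowerSeries ℤ) ^ (p * i)
    have hfac : (P : PowerSeries ℤ) = S * G - S * G * PowerSeries.X := by
      linear_combination -(P : PowerSeries ℤ) * hgeom - G * hPS
    rw [← coeff_coe, hfac, map_sub]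
    cases k with
    | zero =>
      have := hmem 0
      simp only [PowerSeries.coeff_zero_mul_X] at this ⊢
      omega
    | succ k =>
      have h1 := hmem (k + 1)
      have h2 := hmem k
      simp only [PowerSeries.coeff_succ_mul_X] at h1 h2 ⊢
      omega

/-- A window of length `D` contains at most `D / r + 1` terms of a progression with step `r`. -/
theorem card_filter_progression_le (r D k n : ℕ) (hr : 0 < r) :
    ((Finset.range n).filter fun j => r * j ≤ k ∧ k - r * j ≤ D).card ≤ D / r + 1 := by
  have hsub : ((Finset.range n).filter fun j => r * j ≤ k ∧ k - r * j ≤ D) ⊆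
      Finset.Icc (k / r - D / r) (k / r) := by
    intro j hj
    obtain ⟨-, h1, h2⟩ := Finset.mem_filter.1 hj
    rw [Finset.mem_Icc]
    have h3 : k / r ≤ (D + r * j) / r := Nat.div_le_div_right (by omega)
    rw [Nat.add_mul_div_left _ _ hr] at h3
    exact ⟨by omega, (Nat.le_div_iff_mul_le hr).2 (by rwa [mul_comm])⟩
  refine (Finset.card_le_card hsub).trans ?_
  rw [Nat.card_Icc]
  generalize k / r = a, D / r = b
  omega

/-- If `P` is flat of degree at most `D` and `p ≤ q`, then multiplying `P` by
`(X ^ (q * r) - 1) * ∑ i < p, X ^ (r * i)` gives a polynomial of height at most `D / r + 1`. -/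
theorem natAbs_coeff_mul_le {P : ℤ[X]} {D p q r : ℕ} (hdeg : P.natDegree ≤ D)
    (hflat : ∀ k, (P.coeff k).natAbs ≤ 1) (hr : 0 < r) (hpq : p ≤ q) (k : ℕ) :
    ((P * (X ^ (q * r) - 1) * ∑ i ∈ Finset.range p, X ^ (r * i)).coeff k).natAbs ≤
      D / r + 1 := by
  let b : ℕ → ℤ := fun j => (P * X ^ (r * j)).coeff k
  have hb (j : ℕ) : (b j).natAbs ≤ if r * j ≤ k ∧ k - r * j ≤ D then 1 else 0 := by
    simp only [b, coeff_mul_X_pow']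
    split_ifs with h1 h2 h2
    · exact hflat _
    · rw [coeff_eq_zero_of_natDegree_lt (by omega)]
      rfl
    · exact absurd h2.1 h1
    · rfl
  have hexp : (P * (X ^ (q * r) - 1) * ∑ i ∈ Finset.range p, X ^ (r * i)).coeff k =
      ∑ j ∈ Finset.range p, b (q + j) - ∑ j ∈ Finset.range p, b j := by
    rw [← Finset.sum_sub_distrib, Finset.mul_sum, finsetSum_coeff]
    refine Finset.sum_congr rfl fun j _ => ?_
    rw [← coeff_sub]
    congr 1
    ring
  have habs (f : ℕ → ℤ) :
      (∑ j ∈ Finset.range p, f j).natAbs ≤ ∑ j ∈ Finset.range p, (f j).natAbs :=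
    Int.natAbs_sum_le _ _
  calc _ ≤ (∑ j ∈ Finset.range p, b (q + j)).natAbs + (∑ j ∈ Finset.range p, b j).natAbs := by
        rw [hexp]
        exact Int.natAbs_sub_le _ _
    _ ≤ ∑ j ∈ Finset.range p, (b (q + j)).natAbs + ∑ j ∈ Finset.range q, (b j).natAbs :=
        add_le_add (habs _) ((habs _).trans
          (Finset.sum_le_sum_of_subset (Finset.range_subset_range.2 hpq)))
    _ = ∑ j ∈ Finset.range (q + p), (b j).natAbs := by
        rw [Finset.sum_range_add, add_comm]
    _ ≤ ∑ j ∈ Finset.range (q + p), if r * j ≤ k ∧ k - r * j ≤ D then 1 else 0 :=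
        Finset.sum_le_sum fun j _ => hb j
    _ ≤ D / r + 1 := by
        rw [← Finset.card_filter]
        exact card_filter_progression_le r D k _ hr

/-- For pairwise coprime prime powers `p < q < r`: every coefficient `c` of `Ψ*_{pqr}`
satisfies `|c| ≤ ⌊(p−1)(q−1)/r⌋ + 1 ≤ p − 1`; in particular `H(Ψ*_{pqr}) ≤ p − 1`. -/
theorem height_unitaryCyclotomicInv_le (p q r : ℕ)
    (hp : IsPrimePow p) (hq : IsPrimePow q) (hr : IsPrimePow r)
    (hpq : Nat.Coprime p q) (hpr : Nat.Coprime p r) (hqr : Nat.Coprime q r)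
    (h1 : p < q) (h2 : q < r) :
    (∀ j : ℕ, ((unitaryCyclotomicInv (p * q * r)).coeff j).natAbs ≤
      (p - 1) * (q - 1) / r + 1) ∧
    (p - 1) * (q - 1) / r + 1 ≤ p - 1 := by
  have hp1 := hp.one_lt
  constructor
  · intro j
    obtain ⟨P, hP, hdeg, hflat⟩ := exists_flat_polynomial hp1 hq.one_lt hpq
    have hmul := unitaryCyclotomicInv_mul hp hq hr hpq hpr hqr
    have hgeom := Polynomial.X_pow_mul_sub_one_eq p r
    have key : unitaryCyclotomicInv (p * q * r) =
        P * (X ^ (q * r) - 1) * ∑ i ∈ Finset.range p, X ^ (r * i) := by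
      refine mul_right_cancel₀ (mul_ne_zero (mul_ne_zero
        (monic_X_pow_sub_C (1 : ℤ) (show p ≠ 0 by omega)).ne_zero
        (monic_X_pow_sub_C (1 : ℤ) (show q ≠ 0 by omega)).ne_zero)
        (monic_X_pow_sub_C (1 : ℤ) (show r ≠ 0 by omega)).ne_zero) ?_
      simp only [map_one]
      rw [hmul, hgeom]
      linear_combination -(X ^ (q * r) - 1) * (X ^ r - 1) *
        (∑ i ∈ Finset.range p, (X : ℤ[X]) ^ (r * i)) * hP
    rw [key]
    exact natAbs_coeff_mul_le hdeg hflat (by omega) h1.le j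
  · have : (p - 1) * (q - 1) / r < p - 1 :=
      Nat.div_lt_of_lt_mul (by
        rw [mul_comm]
        exact Nat.mul_lt_mul_of_pos_right (by omega) (by omega))
    omega
end
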